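/- arXiv:2103.03001 — 6 statements merged into one kernel-verified Lean document; each statement's English description precedes it below -/
import Mathlib

section
/- Let A = (a_{j,q})_{j∈ℕ,q∈ℕ₀} be a Köthe matrix. Then the following two sets of conditions are equivalent. Set (4): (i) for every q∈ℕ₀ there is r∈ℕ₀ with a_{j,r}>0 for all j and Σ_{j=1}^∞ a_{j,q}/a_{j,r} < ∞; (ii) there exist p∈ℕ₀ and C>0 such that a_{j,p} ≥ 1/C for all j; (iii) A² ≺ A. Set (5): (i) for every q∈ℕ₀ there is r∈ℕ₀ with a_{j,r}>0 for all j and Σ_{j=1}^∞ a_{j,q}/a_{j,r} < ∞; (ii) there exists p∈ℕ₀ such that for every q∈ℕ₀ there are r∈ℕ₀ and C>0 with a_{j,q}² ≤ C a_{j,p} a_{j,r} for all j; (iii) A ~ A². -/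
/-- A Köthe matrix: nonnegative entries, for each `j` some `q` with positive entry,
and increasing in `q`. Indices `j ∈ ℕ` (0-based) and `q ∈ ℕ₀`. -/
def KotheMatrix (a : ℕ → ℕ → ℝ) : Prop :=
  (∀ j q, 0 ≤ a j q) ∧ (∀ j, ∃ q, 0 < a j q) ∧ (∀ j q, a j q ≤ a j (q + 1))

/-- `A ≺ B`: for every `q` there are `r` and `C > 0` with `a j q ≤ C * b j r` for all `j`. -/
def KothePrec (a b : ℕ → ℕ → ℝ) : Prop :=
  ∀ q : ℕ, ∃ r : ℕ, ∃ C : ℝ, 0 < C ∧ ∀ j : ℕ, a j q ≤ C * b j r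

/-- `A ~ B`: `A ≺ B` and `B ≺ A`. -/
def KotheEquiv (a b : ℕ → ℕ → ℝ) : Prop :=
  KothePrec a b ∧ KothePrec b a

/-- The Köthe matrix `A²`, with entries `a j q ^ 2`. -/
def kotheSq (a : ℕ → ℕ → ℝ) : ℕ → ℕ → ℝ := fun j q => a j q ^ 2

/-- The nuclearity condition (Grothendieck–Pietsch): for every `q` there is `r` with
`a j r > 0` for all `j` and `∑ⱼ a j q / a j r < ∞`. -/
def NuclearityCond (a : ℕ → ℕ → ℝ) : Prop :=
  ∀ q : ℕ, ∃ r : ℕ, (∀ j : ℕ, 0 < a j r) ∧ Summable (fun j : ℕ => a j q / a j r)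

/-- Membership in the Köthe space `λ²(A)`. -/
def MemLam2 (a : ℕ → ℕ → ℝ) (ξ : ℕ → ℂ) : Prop :=
  ∀ q : ℕ, Summable (fun j : ℕ => ‖ξ j‖ ^ 2 * a j q ^ 2)

/-- The `q`-th seminorm `|ξ|_{λ²(A),q} = (∑ⱼ |ξ j|² (a j q)²)^{1/2}` of `λ²(A)`. -/
noncomputable def lam2Norm (a : ℕ → ℕ → ℝ) (q : ℕ) (ξ : ℕ → ℂ) : ℝ :=
  Real.sqrt (∑' j : ℕ, ‖ξ j‖ ^ 2 * a j q ^ 2)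

/-- Membership in `ℓ²(ℕ, ℂ)`. -/
def MemEll2 (ξ : ℕ → ℂ) : Prop := Summable (fun j : ℕ => ‖ξ j‖ ^ 2)

/-- The `ℓ²`-norm `‖ξ‖_{ℓ²} = (∑ⱼ |ξ j|²)^{1/2}`. -/
noncomputable def ell2Norm (ξ : ℕ → ℂ) : ℝ := Real.sqrt (∑' j : ℕ, ‖ξ j‖ ^ 2)

/-- The Köthe matrix of the space `s` of rapidly decreasing sequences (0-based indexing,
so the weight is `(j+1)^q`). -/
noncomputable def sMatrix : ℕ → ℕ → ℝ := fun j q => ((j : ℝ) + 1) ^ q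

/-- Membership in the space `s` of rapidly decreasing sequences. -/
def MemS (ξ : ℕ → ℂ) : Prop := MemLam2 sMatrix ξ

/-- The `q`-th norm `|ξ|_q = (∑ⱼ |ξ j|² (j+1)^{2q})^{1/2}` of `s`; note `sNorm 0 = ell2Norm`. -/
noncomputable def sNorm (q : ℕ) (ξ : ℕ → ℂ) : ℝ := lam2Norm sMatrix q ξ

theorem KotheMatrix.mono {a : ℕ → ℕ → ℝ} (hA : KotheMatrix a) (j : ℕ) : Monotone (a j) :=
  monotone_nat_of_le_succ (hA.2.2 j)

/-- A Köthe matrix with a column bounded away from zero satisfies `A ≺ A²`. -/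
theorem KotheMatrix.prec_kotheSq {a : ℕ → ℕ → ℝ} (hA : KotheMatrix a) {p : ℕ} {C : ℝ}
    (hC : 0 < C) (hp : ∀ j, 1 / C ≤ a j p) : KothePrec a (kotheSq a) := by
  intro q
  refine ⟨max p q, C, hC, fun j => ?_⟩
  have h₁ : 1 / C ≤ a j (max p q) := (hp j).trans (hA.mono j (le_max_left p q))
  have h₂ : 1 ≤ C * a j (max p q) := by
    rw [div_le_iff₀ hC] at h₁
    linarith
  calc a j q ≤ a j (max p q) := hA.mono j (le_max_right p q)
    _ ≤ (C * a j (max p q)) * a j (max p q) := le_mul_of_one_le_left (hA.1 j _) h₂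
    _ = C * kotheSq a j (max p q) := by
      simp only [kotheSq]
      ring

/-- The (DN)-type condition at `p` forces `a j p > 0` for every `j`. -/
theorem KotheMatrix.pos_of_sq_le {a : ℕ → ℕ → ℝ} (hA : KotheMatrix a) {p : ℕ}
    (hp : ∀ q : ℕ, ∃ r : ℕ, ∃ C : ℝ, 0 < C ∧ ∀ j : ℕ, a j q ^ 2 ≤ C * a j p * a j r) (j : ℕ) :
    0 < a j p := by
  refine (hA.1 j p).lt_of_ne fun h => ?_
  obtain ⟨q, hq⟩ := hA.2.1 j
  obtain ⟨r, C, -, hr⟩ := hp q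
  have := hr j
  rw [← h] at this
  nlinarith [pow_pos hq 2]

/-- The (DN)-type condition together with `A ≺ A²` bounds some column away from zero. -/
theorem KotheMatrix.exists_lower_bound {a : ℕ → ℕ → ℝ} (hA : KotheMatrix a) {p : ℕ}
    (hp : ∀ q : ℕ, ∃ r : ℕ, ∃ C : ℝ, 0 < C ∧ ∀ j : ℕ, a j q ^ 2 ≤ C * a j p * a j r)
    (hsq : KothePrec a (kotheSq a)) : ∃ m : ℕ, ∃ C : ℝ, 0 < C ∧ ∀ j : ℕ, 1 / C ≤ a j m := by
  obtain ⟨s, C₁, hC₁, h₁⟩ := hsq p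
  obtain ⟨q, C₂, hC₂, h₂⟩ := hsq s
  obtain ⟨r, C₃, hC₃, h₃⟩ := hp q
  simp only [kotheSq] at h₁ h₂
  set K := C₃ * C₁ * C₂ ^ 2 with hK
  have hK₀ : 0 < K := by positivity
  refine ⟨max q r, K + 1, by positivity, fun j => ?_⟩
  have hs : a j s ^ 2 ≤ (C₂ * a j q ^ 2) ^ 2 := pow_le_pow_left₀ (hA.1 j s) (h₂ j) 2
  have hpq : a j p ≤ C₁ * (C₂ * a j q ^ 2) ^ 2 :=
    (h₁ j).trans (mul_le_mul_of_nonneg_left hs hC₁.le)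
  have hq : 0 < a j q := by
    refine (hA.1 j q).lt_of_ne fun h => ?_
    rw [← h] at hpq
    have := hA.pos_of_sq_le hp j
    norm_num at hpq
    linarith
  have hr := hA.1 j r
  have hmain : a j q ^ 2 * 1 ≤ a j q ^ 2 * (K * a j q ^ 2 * a j r) :=
    calc a j q ^ 2 * 1 = a j q ^ 2 := mul_one _
      _ ≤ C₃ * a j p * a j r := h₃ j
      _ ≤ C₃ * (C₁ * (C₂ * a j q ^ 2) ^ 2) * a j r := by gcongr
      _ = a j q ^ 2 * (K * a j q ^ 2 * a j r) := by
        rw [hK]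
        ring
  have hone : 1 ≤ K * a j q ^ 2 * a j r := le_of_mul_le_mul_left hmain (by positivity)
  by_contra! hlt
  set x := a j (max q r)
  have hqx : a j q ≤ x := hA.mono j (le_max_left q r)
  have hrx : a j r ≤ x := hA.mono j (le_max_right q r)
  have hx₀ : 0 < x := hq.trans_le hqx
  rw [lt_div_iff₀ (by positivity)] at hlt
  have hx₁ : x ≤ 1 := by nlinarith
  have hsq₁ : a j q ^ 2 ≤ 1 := pow_le_one₀ hq.le (hqx.trans hx₁)
  have : K * a j q ^ 2 * a j r ≤ K * 1 * x := by gcongr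
  linarith

/-- equivalence of condition set (4) and condition set (5) of Theorem 3.1. -/
theorem statement0 (a : ℕ → ℕ → ℝ) (hA : KotheMatrix a) :
    (NuclearityCond a ∧
      (∃ p : ℕ, ∃ C : ℝ, 0 < C ∧ ∀ j : ℕ, 1 / C ≤ a j p) ∧
      KothePrec (kotheSq a) a) ↔
    (NuclearityCond a ∧
      (∃ p : ℕ, ∀ q : ℕ, ∃ r : ℕ, ∃ C : ℝ, 0 < C ∧ ∀ j : ℕ, a j q ^ 2 ≤ C * a j p * a j r) ∧
      KotheEquiv a (kotheSq a)) := by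
  constructor
  · rintro ⟨hN, ⟨p, C, hC, hp⟩, hsq⟩
    refine ⟨hN, ⟨p, fun q => ?_⟩, hA.prec_kotheSq hC hp, hsq⟩
    obtain ⟨r, D, hD, hr⟩ := hsq q
    refine ⟨r, D * C, by positivity, fun j => (hr j).trans ?_⟩
    have h₁ : 1 ≤ a j p * C := (div_le_iff₀ hC).1 (hp j)
    calc D * a j r ≤ (a j p * C) * (D * a j r) :=
          le_mul_of_one_le_left (mul_nonneg hD.le (hA.1 j r)) h₁
      _ = D * C * a j p * a j r := by ring
  · rintro ⟨hN, ⟨p, hp⟩, hle, hge⟩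
    exact ⟨hN, hA.exists_lower_bound hp hle, hge⟩
end

section
/- Let A = (a_{j,q})_{j∈ℕ,q∈ℕ₀} be a Köthe matrix satisfying: (i) for every q∈ℕ₀ there is r∈ℕ₀ with a_{j,r}>0 for all j and Σ_{j=1}^∞ a_{j,q}/a_{j,r} < ∞; (ii) there exists p∈ℕ₀ such that for every q∈ℕ₀ there are r∈ℕ₀ and C>0 with a_{j,q}² ≤ C a_{j,p} a_{j,r} for all j; (iii) A ~ A². Then λ²(A) ⊆ ℓ²(ℕ,ℂ) and there exist q₃ ∈ ℕ₀ and C > 0 such that ‖ξ‖_{ℓ²} ≤ C |ξ|_{λ²(A),q₃} for every ξ ∈ λ²(A); in particular the ℓ²-norm is a continuous norm on λ²(A). -/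
/-- A Köthe matrix with a dominating norm and `A ≺ A²` has a row of weights bounded away from
zero, as soon as one row is strictly positive. -/
theorem KotheMatrix.exists_one_le_mul {a : ℕ → ℕ → ℝ} (hA : KotheMatrix a)
    (hpos : ∃ r, ∀ j, 0 < a j r)
    (hDN : ∃ p : ℕ, ∀ q : ℕ, ∃ r : ℕ, ∃ C : ℝ, 0 < C ∧ ∀ j : ℕ, a j q ^ 2 ≤ C * a j p * a j r)
    (hsq : KothePrec a (kotheSq a)) :
    ∃ m : ℕ, ∃ L : ℝ, 0 < L ∧ ∀ j, 1 ≤ L * a j m := by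
  obtain ⟨h_nonneg, -, hstep⟩ := hA
  have hmono (j : ℕ) : Monotone (a j) := monotone_nat_of_le_succ (hstep j)
  obtain ⟨p, hp⟩ := hDN
  have hp_pos (j : ℕ) : 0 < a j p := by
    obtain ⟨r, hr⟩ := hpos
    obtain ⟨s, C, -, h⟩ := hp r
    refine (h_nonneg j p).lt_of_ne fun h0 => ?_
    have h1 := h j
    rw [← h0] at h1
    nlinarith [pow_pos (hr j) 2]
  obtain ⟨r, C₁, hC₁, h₁⟩ := hsq p
  obtain ⟨s, C₂, hC₂, h₂⟩ := hsq r
  obtain ⟨t, C₃, hC₃, h₃⟩ := hp s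
  simp only [kotheSq] at h₁ h₂
  refine ⟨max p t, max 1 (C₁ * (C₂ * C₃) ^ 2), by positivity, fun j => ?_⟩
  set K := C₁ * (C₂ * C₃) ^ 2
  have hK : 0 < K := by positivity
  have hr : a j r ≤ C₂ * (C₃ * a j p * a j t) :=
    (h₂ j).trans (mul_le_mul_of_nonneg_left (h₃ j) hC₂.le)
  have hpt : a j p * 1 ≤ a j p * (K * (a j p * a j t ^ 2)) := calc
    a j p * 1 ≤ C₁ * a j r ^ 2 := by simpa using h₁ j
    _ ≤ C₁ * (C₂ * (C₃ * a j p * a j t)) ^ 2 := by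
      have := h_nonneg j r
      gcongr
    _ = a j p * (K * (a j p * a j t ^ 2)) := by ring
  set x := a j (max p t)
  have hx0 : 0 ≤ x := h_nonneg j _
  have hpx : a j p ≤ x := hmono j (le_max_left p t)
  have htx : a j t ≤ x := hmono j (le_max_right p t)
  have hx : 1 ≤ K * x ^ 3 := calc
    1 ≤ K * (a j p * a j t ^ 2) := le_of_mul_le_mul_left hpt (hp_pos j)
    _ ≤ K * (x * x ^ 2) := by
      have := h_nonneg j t
      gcongr
    _ = K * x ^ 3 := by ring
  rcases le_total 1 x with h | h
  · exact h.trans (le_mul_of_one_le_left hx0 (le_max_left _ _))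
  · calc
      1 ≤ K * x ^ 3 := hx
      _ ≤ K * x := by gcongr; exact pow_le_of_le_one hx0 h (by norm_num)
      _ ≤ max 1 K * x := by gcongr; exact le_max_right _ _

/-- If the weights of one row are bounded away from zero, the corresponding seminorm
dominates the `ℓ²`-norm. -/
theorem MemLam2.memEll2_and_ell2Norm_le {a : ℕ → ℕ → ℝ} {ξ : ℕ → ℂ} (hξ : MemLam2 a ξ)
    {m : ℕ} {L : ℝ} (hL : 0 < L) (h : ∀ j, 1 ≤ L * a j m) :
    MemEll2 ξ ∧ ell2Norm ξ ≤ L * lam2Norm a m ξ := by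
  have hle (j : ℕ) : ‖ξ j‖ ^ 2 ≤ L ^ 2 * (‖ξ j‖ ^ 2 * a j m ^ 2) := calc
    ‖ξ j‖ ^ 2 ≤ ‖ξ j‖ ^ 2 * (L * a j m) ^ 2 :=
      le_mul_of_one_le_right (by positivity) (one_le_pow₀ (h j))
    _ = L ^ 2 * (‖ξ j‖ ^ 2 * a j m ^ 2) := by ring
  have hsum := (hξ m).mul_left (L ^ 2)
  have hmem : MemEll2 ξ := hsum.of_nonneg_of_le (fun j => by positivity) hle
  refine ⟨hmem, ?_⟩
  calc
    ell2Norm ξ ≤ √(L ^ 2 * ∑' j : ℕ, ‖ξ j‖ ^ 2 * a j m ^ 2) := by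
      rw [← tsum_mul_left]
      exact Real.sqrt_le_sqrt (Summable.tsum_le_tsum hle hmem hsum)
    _ = L * lam2Norm a m ξ := by
      rw [Real.sqrt_mul (sq_nonneg L), Real.sqrt_sq hL.le, lam2Norm]

/-- under conditions (i), (ii), (iii) of set (5), `λ²(A) ⊆ ℓ²` and the
`ℓ²`-norm is continuous on `λ²(A)`. -/
theorem statement1 (a : ℕ → ℕ → ℝ) (hA : KotheMatrix a)
    (h1 : NuclearityCond a)
    (h2 : ∃ p : ℕ, ∀ q : ℕ, ∃ r : ℕ, ∃ C : ℝ, 0 < C ∧ ∀ j : ℕ, a j q ^ 2 ≤ C * a j p * a j r)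
    (h3 : KotheEquiv a (kotheSq a)) :
    ∃ q₃ : ℕ, ∃ C : ℝ, 0 < C ∧ ∀ ξ : ℕ → ℂ, MemLam2 a ξ →
      MemEll2 ξ ∧ ell2Norm ξ ≤ C * lam2Norm a q₃ ξ := by
  obtain ⟨r, hr, -⟩ := h1 0
  obtain ⟨m, L, hL, h⟩ := hA.exists_one_le_mul ⟨r, hr⟩ h2 h3.1
  exact ⟨m, L, hL, fun ξ hξ => hξ.memEll2_and_ell2Norm_le hL h⟩
end

section
/- Let A = (a_{j,q})_{j∈ℕ,q∈ℕ₀} be a Köthe matrix such that (i) for every q∈ℕ₀ there is r∈ℕ₀ with a_{j,r}>0 for all j and Σ_{j=1}^∞ a_{j,q}/a_{j,r} < ∞, and such that λ²(A) ⊆ ℓ²(ℕ,ℂ) and the ℓ²-norm is a continuous dominating norm on λ²(A). Then there exists a topological embedding V : λ²(A) → s with ‖Vξ‖_{ℓ²} = ‖ξ‖_{ℓ²} for all ξ ∈ λ²(A); moreover, the vectors f_j := V e_j (where e_j is the j-th unit vector) form an orthonormal sequence in ℓ²(ℕ,ℂ) and A ~ (|f_j|_q)_{j∈ℕ,q∈ℕ₀}.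 -/
/-- `V` is a topological embedding of the Köthe space `λ²(A)` into `s`
(expressed, as customary for these metrizable locally convex spaces, through the
fundamental systems of seminorms): `V` maps `λ²(A)` into `s`, is injective on `λ²(A)`,
is continuous, and has continuous inverse on its image. -/
def IsTopEmbeddingIntoS (a : ℕ → ℕ → ℝ) (V : (ℕ → ℂ) →ₗ[ℂ] (ℕ → ℂ)) : Prop :=
  (∀ ξ, MemLam2 a ξ → MemS (V ξ)) ∧
  (∀ ξ, MemLam2 a ξ → V ξ = 0 → ξ = 0) ∧
  (∀ q : ℕ, ∃ r : ℕ, ∃ C : ℝ, 0 < C ∧ ∀ ξ, MemLam2 a ξ → sNorm q (V ξ) ≤ C * lam2Norm a r ξ) ∧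
  (∀ q : ℕ, ∃ r : ℕ, ∃ C : ℝ, 0 < C ∧ ∀ ξ, MemLam2 a ξ → lam2Norm a q ξ ≤ C * sNorm r (V ξ))

/-- `u` is bounded by a multiple of some column of `a`. -/
def ColumnBounded (a : ℕ → ℕ → ℝ) (u : ℕ → ℝ) : Prop :=
  ∃ r : ℕ, ∃ C : ℝ, 0 < C ∧ ∀ j : ℕ, u j ≤ C * a j r

namespace ColumnBounded

variable {a : ℕ → ℕ → ℝ} {u v : ℕ → ℝ}

theorem mono (hv : ColumnBounded a v) (h : ∀ j, u j ≤ v j) : ColumnBounded a u := by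
  obtain ⟨r, C, hC, hr⟩ := hv
  exact ⟨r, C, hC, fun j => (h j).trans (hr j)⟩

theorem const_mul (hA : KotheMatrix a) (hu : ColumnBounded a u) (c : ℝ) :
    ColumnBounded a (fun j => |c| * u j) := by
  obtain ⟨r, C, hC, hr⟩ := hu
  refine ⟨r, |c| * C + 1, by positivity, fun j => ?_⟩
  have := mul_le_mul_of_nonneg_left (hr j) (abs_nonneg c)
  have := hA.1 j r
  nlinarith

theorem add (hA : KotheMatrix a) (hu : ColumnBounded a u) (hv : ColumnBounded a v) :
    ColumnBounded a (fun j => u j + v j) := by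
  obtain ⟨r, C, hC, hr⟩ := hu
  obtain ⟨t, D, hD, ht⟩ := hv
  refine ⟨max r t, C + D, by positivity, fun j => ?_⟩
  have hm : Monotone (a j) := monotone_nat_of_le_succ (hA.2.2 j)
  have h1 := mul_le_mul_of_nonneg_left (hm (le_max_left r t)) hC.le
  have h2 := mul_le_mul_of_nonneg_left (hm (le_max_right r t)) hD.le
  linarith [hr j, ht j]

theorem mul (hA : KotheMatrix a) (hsq : ∀ q, ColumnBounded a (fun j => a j q ^ 2))
    (hv0 : ∀ j, 0 ≤ v j) (hu : ColumnBounded a u) (hv : ColumnBounded a v) :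
    ColumnBounded a (fun j => u j * v j) := by
  obtain ⟨r, C, hC, hr⟩ := hu
  obtain ⟨t, D, hD, ht⟩ := hv
  refine ((hsq (max r t)).const_mul hA (C * D)).mono fun j => ?_
  have hm : Monotone (a j) := monotone_nat_of_le_succ (hA.2.2 j)
  have h1 := (hr j).trans (mul_le_mul_of_nonneg_left (hm (le_max_left r t)) hC.le)
  have h2 := (ht j).trans (mul_le_mul_of_nonneg_left (hm (le_max_right r t)) hD.le)
  have h3 := hA.1 j (max r t)
  rw [abs_of_pos (by positivity)]
  calc u j * v j ≤ (C * a j (max r t)) * (D * a j (max r t)) :=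
        mul_le_mul h1 h2 (hv0 j) (by positivity)
    _ = C * D * a j (max r t) ^ 2 := by ring

theorem const (hA : KotheMatrix a) (hone : ColumnBounded a (fun _ => 1)) (c : ℝ) :
    ColumnBounded a (fun _ => c) :=
  (hone.const_mul hA c).mono fun _ => by simpa using le_abs_self c

theorem pow (hA : KotheMatrix a) (hu : ColumnBounded a u) (hone : ColumnBounded a (fun _ => 1))
    (hsq : ∀ q, ColumnBounded a (fun j => a j q ^ 2)) (hu0 : ∀ j, 0 ≤ u j) (n : ℕ) :
    ColumnBounded a (fun j => u j ^ n) := by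
  induction n with
  | zero => simpa using hone
  | succ n ih => simpa only [pow_succ] using ih.mul hA hsq hu0 hu

theorem sum (hA : KotheMatrix a) (hone : ColumnBounded a (fun _ => 1))
    {w : ℕ → ℕ → ℝ} (hw : ∀ k, ColumnBounded a (w k)) (n : ℕ) :
    ColumnBounded a (fun j => ∑ k ∈ Finset.range n, w k j) := by
  induction n with
  | zero => simpa using hone.const hA 0
  | succ n ih => simpa only [Finset.sum_range_succ] using ih.add hA (hw n)

theorem natPair {x y : ℕ → ℕ} (hA : KotheMatrix a)
    (hx : ColumnBounded a (fun j => (x j : ℝ))) (hone : ColumnBounded a (fun _ => 1))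
    (hsq : ∀ q, ColumnBounded a (fun j => a j q ^ 2)) (hy : ColumnBounded a (fun j => (y j : ℝ))) :
    ColumnBounded a (fun j => (Nat.pair (x j) (y j) : ℝ)) := by
  refine (((hx.add hA hy).add hA hone).pow hA hone hsq (fun j => by positivity) 2).mono
    fun j => ?_
  have h1 := (Nat.pair_lt_max_add_one_sq (x j) (y j)).le
  have h2 : (max (x j) (y j) + 1) ^ 2 ≤ (x j + y j + 1) ^ 2 := by
    gcongr
    omega
  exact_mod_cast h1.trans h2

theorem natCeil (hA : KotheMatrix a) (hone : ColumnBounded a (fun _ => 1)) (q : ℕ) :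
    ColumnBounded a (fun j => ((⌈a j q⌉₊ : ℕ) : ℝ)) := by
  have h : ColumnBounded a (fun j => a j q) := ⟨q, 1, one_pos, fun j => by simp⟩
  exact (h.add hA hone).mono fun j => (Nat.ceil_lt_add_one (hA.1 j q)).le

end ColumnBounded

/-- The number of `i < j` with `m i = m j`. -/
def fiberRank (m : ℕ → ℕ) (j : ℕ) : ℕ := ((Finset.range j).filter (fun i => m i = m j)).card

theorem fiberRank_lt {m : ℕ → ℕ} {i j : ℕ} (hij : i < j) (h : m i = m j) :
    fiberRank m i < fiberRank m j := by
  refine Finset.card_lt_card ⟨fun x hx => ?_, fun hs => ?_⟩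
  · simp only [Finset.mem_filter, Finset.mem_range] at hx ⊢
    exact ⟨hx.1.trans hij, hx.2.trans h⟩
  · have : i ∈ (Finset.range i).filter (fun x => m x = m i) :=
      hs (by simp [hij, h])
    simp at this

theorem fiberRank_injective {m : ℕ → ℕ} {i j : ℕ} (h : m i = m j)
    (hr : fiberRank m i = fiberRank m j) : i = j := by
  rcases lt_trichotomy i j with hij | hij | hij
  · exact absurd hr (fiberRank_lt hij h).ne
  · exact hij
  · exact absurd hr (fiberRank_lt hij h.symm).ne'

theorem fiberRank_natCeil_le {b : ℕ → ℝ} (hb : ∀ j, 0 < b j) (hs : Summable fun j => (b j)⁻¹)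
    (j : ℕ) : (fiberRank (fun i => ⌈b i⌉₊) j : ℝ) ≤ (∑' i, (b i)⁻¹) * ⌈b j⌉₊ := by
  have hm : (0 : ℝ) < ⌈b j⌉₊ := by exact_mod_cast Nat.ceil_pos.2 (hb j)
  rw [← div_le_iff₀ hm, div_eq_mul_inv, fiberRank, ← nsmul_eq_mul]
  refine le_trans (Finset.card_nsmul_le_sum _ (fun i => (b i)⁻¹) _ fun i hi => ?_)
    (hs.sum_le_tsum _ fun i _ => (inv_pos.2 (hb i)).le)
  have hi' := (Finset.mem_filter.1 hi).2
  have : b i ≤ ⌈b j⌉₊ := hi' ▸ Nat.le_ceil (b i)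
  exact inv_anti₀ (hb i) this

/-- A nuclear Köthe matrix satisfying the matrix form of the domination condition admits an
injective indexing of `ℕ × ℕ` whose columns are equivalent to those of the matrix. -/
theorem exists_injective_index {a : ℕ → ℕ → ℝ} (hA : KotheMatrix a) (h1 : NuclearityCond a)
    (hone : ColumnBounded a (fun _ => 1)) (hsq : ∀ q, ColumnBounded a (fun j => a j q ^ 2)) :
    ∃ n : ℕ × ℕ → ℕ, Function.Injective n ∧ (∀ p, 1 ≤ n p) ∧
      (∀ j q, a j q ≤ n (j, q)) ∧ ∀ k, ColumnBounded a (fun j => (n (j, k) : ℝ)) := by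
  obtain ⟨r₀, C, hC, hr₀⟩ := id hone
  obtain ⟨R, hR, hs⟩ := h1 r₀
  have hs' : Summable fun j => (a j R)⁻¹ := by
    refine (hs.mul_left C).of_nonneg_of_le (fun j => (inv_pos.2 (hR j)).le) fun j => ?_
    rw [← mul_div_assoc, inv_eq_one_div]
    exact div_le_div_of_nonneg_right (hr₀ j) (hR j).le
  set m : ℕ → ℕ := fun j => ⌈a j R⌉₊ with hm
  have hmb : ColumnBounded a (fun j => (m j : ℝ)) := .natCeil hA hone R
  have htb : ColumnBounded a (fun j => (fiberRank m j : ℝ)) :=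
    (hmb.const_mul hA (∑' i, (a i R)⁻¹)).mono fun j =>
      (fiberRank_natCeil_le hR hs' j).trans
        (mul_le_mul_of_nonneg_right (le_abs_self _) (Nat.cast_nonneg _))
  refine ⟨fun p => Nat.pair (Nat.pair (m p.1) (fiberRank m p.1))
    (Nat.pair p.2 ⌈a p.1 p.2⌉₊) + 1, ?_, fun p => by simp, fun j q => ?_, fun k => ?_⟩
  · rintro ⟨i, k⟩ ⟨j, l⟩ h
    simp only [add_left_inj, Nat.pair_eq_pair] at h
    obtain ⟨⟨hmm, ht⟩, hk, -⟩ := h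
    rw [fiberRank_injective hmm ht, hk]
  · have h2 : ⌈a j q⌉₊ ≤ Nat.pair (Nat.pair (m j) (fiberRank m j)) (Nat.pair q ⌈a j q⌉₊) + 1 :=
      ((Nat.right_le_pair _ _).trans (Nat.right_le_pair _ _)).trans (Nat.le_succ _)
    exact (Nat.le_ceil _).trans (by exact_mod_cast h2)
  · have := ((hmb.natPair hA hone hsq htb).natPair hA hone hsq
      ((hone.const hA (k : ℝ)).natPair hA hone hsq (x := fun _ => k)
        (.natCeil hA hone k))).add hA hone
    simpa only [Nat.cast_add, Nat.cast_one] using this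

/-- Squared `q`-th norm of the `j`-th unnormalized block `∑ₖ N j k ^ (-k) e_{N j k}`. -/
noncomputable def blockSq (N : ℕ → ℕ → ℝ) (j q : ℕ) : ℝ :=
  ∑' k : ℕ, (((N j k) ^ k)⁻¹ ^ 2 * ((N j k) ^ q) ^ 2)

section Block

variable {N : ℕ → ℕ → ℝ}

theorem block_term_le (hN : ∀ j k, 2 ≤ N j k) (j q k : ℕ) :
    ((N j k) ^ k)⁻¹ ^ 2 * ((N j k) ^ q) ^ 2 ≤
      4 ^ q * (1 / 4 : ℝ) ^ k + if k < q then N j k ^ (2 * q) else 0 := by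
  have h2 := hN j k
  have h0 : (0 : ℝ) < N j k := by linarith
  split_ifs with h
  · have h3 : ((N j k) ^ k)⁻¹ ^ 2 ≤ 1 :=
      pow_le_one₀ (by positivity) (inv_le_one_of_one_le₀ (one_le_pow₀ (by linarith)))
    have h4 : (0 : ℝ) ≤ 4 ^ q * (1 / 4 : ℝ) ^ k := by positivity
    have h5 : ((N j k) ^ q) ^ 2 = N j k ^ (2 * q) := by rw [← pow_mul, mul_comm]
    rw [h5]
    have := mul_le_of_le_one_left (b := N j k ^ (2 * q)) (by positivity) h3
    linarith
  · obtain ⟨d, rfl⟩ := Nat.exists_eq_add_of_le (not_lt.1 h)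
    have e1 : ((N j (q + d)) ^ (q + d))⁻¹ ^ 2 * ((N j (q + d)) ^ q) ^ 2 =
        ((N j (q + d) ^ 2)⁻¹) ^ d := by
      have h1 : N j (q + d) ≠ 0 := h0.ne'
      rw [inv_pow, inv_pow, ← pow_mul, ← pow_mul, ← pow_mul, inv_mul_eq_div,
        div_eq_iff (by positivity), eq_inv_mul_iff_mul_eq₀ (by positivity), ← pow_add]
      ring
    have e2 : (4 : ℝ) ^ q * (1 / 4 : ℝ) ^ (q + d) = (1 / 4) ^ d := by
      rw [pow_add, ← mul_assoc, ← mul_pow]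
      norm_num
    rw [e1, e2, add_zero]
    refine pow_le_pow_left₀ (by positivity) ?_ _
    rw [inv_le_comm₀ (by positivity) (by norm_num)]
    nlinarith

theorem summable_block_bound (j q : ℕ) : Summable fun k : ℕ =>
    4 ^ q * (1 / 4 : ℝ) ^ k + if k < q then N j k ^ (2 * q) else 0 := by
  refine ((summable_geometric_of_lt_one (by norm_num) (by norm_num)).mul_left _).add ?_
  exact summable_of_ne_finset_zero (s := Finset.range q) fun k hk => by
    simp_all

theorem summable_block (hN : ∀ j k, 2 ≤ N j k) (j q : ℕ) :
    Summable fun k : ℕ => ((N j k) ^ k)⁻¹ ^ 2 * ((N j k) ^ q) ^ 2 :=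
  (summable_block_bound j q).of_nonneg_of_le (fun k => by positivity)
    (block_term_le hN j q)

theorem blockSq_le (hN : ∀ j k, 2 ≤ N j k) (j q : ℕ) :
    blockSq N j q ≤ 4 ^ q * (4 / 3) + ∑ k ∈ Finset.range q, N j k ^ (2 * q) := by
  refine ((summable_block hN j q).tsum_le_tsum (block_term_le hN j q)
    (summable_block_bound j q)).trans_eq ?_
  have hz : ∀ k ∉ Finset.range q, (if k < q then N j k ^ (2 * q) else 0) = 0 := by
    intro k hk
    simp_all
  rw [Summable.tsum_add ((summable_geometric_of_lt_one (by norm_num) (by norm_num)).mul_left _)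
    (summable_of_ne_finset_zero hz), tsum_eq_sum hz, tsum_mul_left,
    tsum_geometric_of_lt_one (by norm_num) (by norm_num)]
  congr 1
  · norm_num
  · exact Finset.sum_congr rfl fun k hk => if_pos (Finset.mem_range.1 hk)

theorem le_blockSq (hN : ∀ j k, 2 ≤ N j k) (j q k : ℕ) :
    ((N j k) ^ k)⁻¹ ^ 2 * ((N j k) ^ q) ^ 2 ≤ blockSq N j q :=
  (summable_block hN j q).le_tsum k fun _ _ => by positivity

theorem one_le_blockSq_zero (hN : ∀ j k, 2 ≤ N j k) (j : ℕ) : 1 ≤ blockSq N j 0 := by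
  simpa using le_blockSq hN j 0 0

theorem blockSq_zero_le (hN : ∀ j k, 2 ≤ N j k) (j : ℕ) : blockSq N j 0 ≤ 4 / 3 := by
  simpa using blockSq_le hN j 0

end Block

/-- The norms of the normalized blocks. -/
noncomputable def blockNorm (N : ℕ → ℕ → ℝ) (j q : ℕ) : ℝ :=
  Real.sqrt (blockSq N j q / blockSq N j 0)

/-- Coefficients of the normalized blocks. -/
noncomputable def blockCoeff (N : ℕ → ℕ → ℝ) (j k : ℕ) : ℝ :=
  ((N j k) ^ k)⁻¹ / Real.sqrt (blockSq N j 0)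

theorem hasSum_blockCoeff {N : ℕ → ℕ → ℝ} (hN : ∀ j k, 2 ≤ N j k) (j q : ℕ) :
    HasSum (fun k => blockCoeff N j k ^ 2 * ((N j k) ^ q) ^ 2) (blockNorm N j q ^ 2) := by
  have h1 := one_le_blockSq_zero hN j
  have h2 : 0 ≤ blockSq N j q := tsum_nonneg fun k => by positivity
  rw [blockNorm, Real.sq_sqrt (by positivity)]
  refine ((summable_block hN j q).hasSum.div_const (blockSq N j 0)).congr_fun fun k => ?_
  rw [blockCoeff, div_pow, Real.sq_sqrt (by positivity)]
  ring

theorem blockNorm_zero {N : ℕ → ℕ → ℝ} (hN : ∀ j k, 2 ≤ N j k) (j : ℕ) :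
    blockNorm N j 0 = 1 := by
  have := one_le_blockSq_zero hN j
  rw [blockNorm, div_self (by positivity), Real.sqrt_one]

theorem le_two_mul_blockNorm {N : ℕ → ℕ → ℝ} (hN : ∀ j k, 2 ≤ N j k) (j q : ℕ) :
    N j q ≤ 2 * blockNorm N j (q + 1) := by
  have h1 := one_le_blockSq_zero hN j
  have h2 := blockSq_zero_le hN j
  have h3 := le_blockSq hN j (q + 1) q
  have h4 := hN j q
  have h5 : ((N j q) ^ q)⁻¹ ^ 2 * ((N j q) ^ (q + 1)) ^ 2 = N j q ^ 2 := by
    have h0 : N j q ≠ 0 := by positivity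
    rw [pow_succ (N j q) q, ← mul_pow, ← mul_assoc, inv_mul_cancel₀ (by positivity), one_mul]
  rw [h5] at h3
  have h6 : N j q / 2 ≤ blockNorm N j (q + 1) := by
    refine Real.le_sqrt_of_sq_le ?_
    rw [le_div_iff₀ (by positivity)]
    nlinarith
  linarith

theorem columnBounded_blockNorm {a N : ℕ → ℕ → ℝ} (hN : ∀ j k, 2 ≤ N j k)
    (hA : KotheMatrix a) (hone : ColumnBounded a (fun _ => 1))
    (hsq : ∀ q, ColumnBounded a (fun j => a j q ^ 2))
    (hNb : ∀ k, ColumnBounded a (fun j => N j k)) (q : ℕ) :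
    ColumnBounded a (fun j => blockNorm N j q) := by
  have h := (hone.const hA (1 + 4 ^ q * (4 / 3))).add hA
    (ColumnBounded.sum hA hone (fun k => (hNb k).pow hA hone hsq
      (fun j => by linarith [hN j k]) (2 * q)) q)
  refine h.mono fun j => ?_
  have h1 := one_le_blockSq_zero hN j
  have h2 : 0 ≤ blockSq N j q := tsum_nonneg fun k => by positivity
  have h3 := blockSq_le hN j q
  have h4 : blockNorm N j q ≤ 1 + blockSq N j q := by
    refine Real.sqrt_le_iff.2 ⟨by positivity, (div_le_self h2 h1).trans ?_⟩
    nlinarith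
  linarith

/-- The linear map spreading the `j`-th coordinate over the indices `n (j, k)`, `k ∈ ℕ`, with
coefficients `c j k`. -/
noncomputable def spread (n : ℕ × ℕ → ℕ) (c : ℕ → ℕ → ℝ) : (ℕ → ℂ) →ₗ[ℂ] (ℕ → ℂ) :=
  Function.ExtendByZero.linearMap ℂ n ∘ₗ
    LinearMap.pi fun p : ℕ × ℕ => (c p.1 p.2 : ℂ) • LinearMap.proj p.1

section Spread

variable {n : ℕ × ℕ → ℕ}

theorem spread_apply (hn : Function.Injective n) (c : ℕ → ℕ → ℝ) (ξ : ℕ → ℂ) (p : ℕ × ℕ) :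
    spread n c ξ (n p) = c p.1 p.2 * ξ p.1 := by
  change Function.extend n _ 0 (n p) = _
  rw [hn.extend_apply]
  rfl

theorem spread_apply_of_notMem (c : ℕ → ℕ → ℝ) (ξ : ℕ → ℂ) {i : ℕ} (hi : i ∉ Set.range n) :
    spread n c ξ i = 0 := by
  exact Function.extend_apply' _ _ _ hi

theorem hasSum_spread (hn : Function.Injective n) (c : ℕ → ℕ → ℝ)
    {b : ℕ → ℕ → ℝ} {q : ℕ} {ξ : ℕ → ℂ}
    (hb : ∀ j, HasSum (fun k => c j k ^ 2 * (((n (j, k) : ℝ) + 1) ^ q) ^ 2) (b j q ^ 2))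
    (hs : Summable fun j => ‖ξ j‖ ^ 2 * b j q ^ 2) :
    HasSum (fun i => ‖spread n c ξ i‖ ^ 2 * sMatrix i q ^ 2)
      (∑' j, ‖ξ j‖ ^ 2 * b j q ^ 2) := by
  rw [← hn.hasSum_iff fun i hi => by simp [spread_apply_of_notMem c ξ hi]]
  have hf : ∀ j, HasSum (fun k => ‖ξ j‖ ^ 2 * (c j k ^ 2 * (((n (j, k) : ℝ) + 1) ^ q) ^ 2))
      (‖ξ j‖ ^ 2 * b j q ^ 2) := fun j => (hb j).mul_left _
  have hS : Summable fun p : ℕ × ℕ =>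
      ‖ξ p.1‖ ^ 2 * (c p.1 p.2 ^ 2 * (((n p : ℝ) + 1) ^ q) ^ 2) := by
    rw [summable_prod_of_nonneg (fun p => by positivity)]
    refine ⟨fun j => (hf j).summable, ?_⟩
    simpa only [(hf _).tsum_eq] using hs
  have h := hS.hasSum
  rw [hS.tsum_prod] at h
  simp only [(hf _).tsum_eq] at h
  refine h.congr_fun fun p => ?_
  simp only [Function.comp, spread_apply hn, sMatrix, norm_mul, Complex.norm_real,
    Real.norm_eq_abs, mul_pow, sq_abs]
  ring

theorem sNorm_spread (hn : Function.Injective n) (c : ℕ → ℕ → ℝ)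
    {b : ℕ → ℕ → ℝ} {q : ℕ} {ξ : ℕ → ℂ}
    (hb : ∀ j, HasSum (fun k => c j k ^ 2 * (((n (j, k) : ℝ) + 1) ^ q) ^ 2) (b j q ^ 2))
    (hs : Summable fun j => ‖ξ j‖ ^ 2 * b j q ^ 2) :
    sNorm q (spread n c ξ) = lam2Norm b q ξ := by
  rw [sNorm, lam2Norm, lam2Norm, (hasSum_spread hn c hb hs).tsum_eq]

end Spread

theorem summable_of_le_column {u v : ℕ → ℝ} {C : ℝ} (hu : ∀ j, 0 ≤ u j)
    (h : ∀ j, u j ≤ C * v j) {ξ : ℕ → ℂ} (hs : Summable fun j => ‖ξ j‖ ^ 2 * v j ^ 2) :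
    Summable fun j => ‖ξ j‖ ^ 2 * u j ^ 2 := by
  refine (hs.mul_left (C ^ 2)).of_nonneg_of_le (fun j => by positivity) fun j => ?_
  have := mul_le_mul_of_nonneg_left (pow_le_pow_left₀ (hu j) (h j) 2) (sq_nonneg ‖ξ j‖)
  linarith [mul_left_comm (‖ξ j‖ ^ 2) (C ^ 2) (v j ^ 2),
    congrArg (‖ξ j‖ ^ 2 * ·) (mul_pow C (v j) 2)]

theorem lam2Norm_le_of_le_column {a b : ℕ → ℕ → ℝ} {q r : ℕ} {C : ℝ} (hC : 0 < C)
    (ha : ∀ j, 0 ≤ a j q) (h : ∀ j, a j q ≤ C * b j r) {ξ : ℕ → ℂ}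
    (hs : Summable fun j => ‖ξ j‖ ^ 2 * b j r ^ 2) :
    lam2Norm a q ξ ≤ C * lam2Norm b r ξ := by
  have h0 : ∀ x : ℝ, C * Real.sqrt x = Real.sqrt (C ^ 2 * x) := fun x => by
    rw [Real.sqrt_mul (sq_nonneg C), Real.sqrt_sq hC.le]
  rw [lam2Norm, lam2Norm, h0, ← tsum_mul_left]
  refine Real.sqrt_le_sqrt ((summable_of_le_column ha h hs).tsum_le_tsum (fun j => ?_)
    (hs.mul_left _))
  have := mul_le_mul_of_nonneg_left (pow_le_pow_left₀ (ha j) (h j) 2) (sq_nonneg ‖ξ j‖)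
  linarith [congrArg (‖ξ j‖ ^ 2 * ·) (mul_pow C (b j r) 2),
    mul_left_comm (‖ξ j‖ ^ 2) (C ^ 2) (b j r ^ 2)]

theorem norm_single_sq_mul (j : ℕ) (w : ℕ → ℝ) :
    (fun i => ‖(Pi.single j 1 : ℕ → ℂ) i‖ ^ 2 * w i) = Pi.single j (w j) := by
  ext i
  rcases eq_or_ne i j with rfl | h
  · simp
  · simp [h]

theorem memLam2_single (a : ℕ → ℕ → ℝ) (j : ℕ) : MemLam2 a (Pi.single j 1) := fun q => by
  rw [norm_single_sq_mul j fun i => a i q ^ 2]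
  exact (hasSum_pi_single j _).summable

theorem lam2Norm_single {a : ℕ → ℕ → ℝ} {q : ℕ} {j : ℕ} (ha : 0 ≤ a j q) :
    lam2Norm a q (Pi.single j 1) = a j q := by
  rw [lam2Norm, norm_single_sq_mul j fun i => a i q ^ 2, tsum_pi_single, Real.sqrt_sq ha]

theorem lam2Norm_eq_ell2Norm {b : ℕ → ℕ → ℝ} {q : ℕ} (hb : ∀ j, b j q = 1) (ξ : ℕ → ℂ) :
    lam2Norm b q ξ = ell2Norm ξ := by
  simp [lam2Norm, ell2Norm, hb]

theorem ell2Norm_single (j : ℕ) : ell2Norm (Pi.single j 1) = 1 := by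
  rw [← lam2Norm_eq_ell2Norm (b := fun _ _ => 1) (q := 0) fun _ => rfl]
  exact lam2Norm_single zero_le_one

/-- if `A` is a nuclear Köthe matrix such that `λ²(A) ⊆ ℓ²` and the `ℓ²`-norm
is a continuous dominating norm on `λ²(A)`, then there is a topological embedding
`V : λ²(A) → s` preserving the `ℓ²`-norm; moreover the vectors `f_j = V e_j` form an
orthonormal sequence in `ℓ²` and `A ~ (|f_j|_q)`. -/
theorem statement3 (a : ℕ → ℕ → ℝ) (hA : KotheMatrix a)
    (h1 : NuclearityCond a)
    (hsub : ∀ ξ, MemLam2 a ξ → MemEll2 ξ)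
    (hcont : ∃ r : ℕ, ∃ C : ℝ, 0 < C ∧ ∀ ξ, MemLam2 a ξ → ell2Norm ξ ≤ C * lam2Norm a r ξ)
    (hdom : ∀ q : ℕ, ∃ r : ℕ, ∃ C : ℝ, 0 < C ∧ ∀ ξ, MemLam2 a ξ →
      lam2Norm a q ξ ^ 2 ≤ C * ell2Norm ξ * lam2Norm a r ξ) :
    ∃ V : (ℕ → ℂ) →ₗ[ℂ] (ℕ → ℂ),
      IsTopEmbeddingIntoS a V ∧
      (∀ ξ, MemLam2 a ξ → ell2Norm (V ξ) = ell2Norm ξ) ∧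
      (∀ j k : ℕ,
        (∑' i : ℕ, (starRingEnd ℂ) (V (Pi.single j 1) i) * V (Pi.single k 1) i) =
          if j = k then 1 else 0) ∧
      KotheEquiv a (fun j q => sNorm q (V (Pi.single j 1))) := by
  have hone : ColumnBounded a (fun _ => 1) := by
    obtain ⟨r, C, hC, h⟩ := hcont
    refine ⟨r, C, hC, fun j => ?_⟩
    have := h _ (memLam2_single a j)
    rwa [ell2Norm_single, lam2Norm_single (hA.1 j r)] at this
  have hsq : ∀ q, ColumnBounded a (fun j => a j q ^ 2) := fun q => by
    obtain ⟨r, C, hC, h⟩ := hdom q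
    refine ⟨r, C, hC, fun j => ?_⟩
    have := h _ (memLam2_single a j)
    rwa [ell2Norm_single, lam2Norm_single (hA.1 j r), lam2Norm_single (hA.1 j q), mul_one] at this
  obtain ⟨n, hn, hn1, han, hnb⟩ := exists_injective_index hA h1 hone hsq
  set N : ℕ → ℕ → ℝ := fun j k => (n (j, k) : ℝ) + 1 with hNdef
  have hN : ∀ j k, 2 ≤ N j k := fun j k => by
    have : (1 : ℝ) ≤ n (j, k) := by exact_mod_cast hn1 (j, k)
    simp only [hNdef]
    linarith
  have hba : KothePrec (blockNorm N) a :=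
    columnBounded_blockNorm hN hA hone hsq fun k => (hnb k).add hA hone
  have hab : KothePrec a (blockNorm N) := fun q =>
    ⟨q + 1, 2, two_pos, fun j => ((han j q).trans (by simp [hNdef])).trans
      (le_two_mul_blockNorm hN j q)⟩
  have hb0 : ∀ j q, 0 ≤ blockNorm N j q := fun j q => Real.sqrt_nonneg _
  have hmem : ∀ ξ, MemLam2 a ξ → MemLam2 (blockNorm N) ξ := fun ξ hξ q => by
    obtain ⟨r, C, hC, h⟩ := hba q
    exact summable_of_le_column (fun j => hb0 j q) h (hξ r)
  have hnorm : ∀ q ξ, MemLam2 a ξ →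
      sNorm q (spread n (blockCoeff N) ξ) = lam2Norm (blockNorm N) q ξ := fun q ξ hξ =>
    sNorm_spread hn _ (fun j => hasSum_blockCoeff hN j q) (hmem ξ hξ q)
  have hsingle : ∀ j q, sNorm q (spread n (blockCoeff N) (Pi.single j 1)) = blockNorm N j q :=
    fun j q => by rw [hnorm q _ (memLam2_single a j), lam2Norm_single (hb0 j q)]
  have hell : ∀ ξ, MemLam2 a ξ → ell2Norm (spread n (blockCoeff N) ξ) = ell2Norm ξ :=
    fun ξ hξ => by
      rw [← lam2Norm_eq_ell2Norm (b := blockNorm N) (q := 0) (blockNorm_zero hN) ξ, ← hnorm 0 ξ hξ,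
        sNorm, lam2Norm_eq_ell2Norm (fun j => by simp [sMatrix])]
  refine ⟨spread n (blockCoeff N), ⟨fun ξ hξ q => ?_, fun ξ _ h => ?_, fun q => ?_, fun q => ?_⟩,
    hell, fun j k => ?_, ?_⟩
  · exact (hasSum_spread hn _ (fun j => hasSum_blockCoeff hN j q) (hmem ξ hξ q)).summable
  · ext j
    have h2 := congrFun h (n (j, 0))
    rw [spread_apply hn] at h2
    have h3 : blockCoeff N j 0 ≠ 0 := by
      have := one_le_blockSq_zero hN j
      simp only [blockCoeff, pow_zero, inv_one]
      positivity
    simpa [h3] using h2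
  · obtain ⟨r, C, hC, h⟩ := hba q
    refine ⟨r, C, hC, fun ξ hξ => ?_⟩
    rw [hnorm q ξ hξ]
    exact lam2Norm_le_of_le_column hC (fun j => hb0 j q) h (hξ r)
  · obtain ⟨r, C, hC, h⟩ := hab q
    refine ⟨r, C, hC, fun ξ hξ => ?_⟩
    rw [hnorm r ξ hξ]
    exact lam2Norm_le_of_le_column hC (fun j => hA.1 j q) h (hmem ξ hξ r)
  · split_ifs with hjk
    · subst hjk
      have h2 := hell _ (memLam2_single a j)
      rw [ell2Norm_single, ell2Norm, Real.sqrt_eq_one] at h2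
      simp only [Complex.conj_mul']
      exact_mod_cast h2
    · refine (tsum_congr fun i => ?_).trans tsum_zero
      by_cases hi : i ∈ Set.range n
      · obtain ⟨p, rfl⟩ := hi
        rw [spread_apply hn, spread_apply hn]
        rcases eq_or_ne p.1 j with hp | hp
        · simp [hp, hjk]
        · simp [hp]
      · simp [spread_apply_of_notMem _ _ hi]
  · simp only [hsingle]
    exact ⟨hab, hba⟩
end

section
/- Let A = (a_{j,q})_{j∈ℕ,q∈ℕ₀} be a Köthe matrix satisfying the nuclearity condition: for every q∈ℕ₀ there is r∈ℕ₀ with a_{j,r}>0 for all j and Σ_{j=1}^∞ a_{j,q}/a_{j,r} < ∞. If λ²(A) is closed under taking square roots, i.e. for every ξ ∈ λ²(A) with ξ_j ≥ 0 for all j the sequence (√ξ_j)_{j∈ℕ} also belongs to λ²(A), then A² ≺ A. -/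
/-- If `A² ≺ A` fails at the index `q`, witnesses of the failure exist at arbitrarily
large indices `j`. -/
theorem frequently_lt_sq_of_not_exists_bound {a : ℕ → ℕ → ℝ} (hA : KotheMatrix a)
    {r₀ : ℕ} (hr₀ : ∀ j, 0 < a j r₀) {q : ℕ}
    (hq : ¬ ∃ r : ℕ, ∃ C : ℝ, 0 < C ∧ ∀ j : ℕ, a j q ^ 2 ≤ C * a j r) (n : ℕ) :
    ∃ᶠ j in Filter.atTop, 2 ^ n * a j n < a j q ^ 2 := by
  have hmono : ∀ j, Monotone (a j) := fun j => monotone_nat_of_le_succ (hA.2.2 j)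
  intro hev
  obtain ⟨N, hN⟩ := Filter.eventually_atTop.1 hev
  have hnn : ∀ j, 0 ≤ a j q ^ 2 / a j r₀ := fun j => div_nonneg (sq_nonneg _) (hr₀ j).le
  have hS : 0 ≤ ∑ j ∈ Finset.range N, a j q ^ 2 / a j r₀ :=
    Finset.sum_nonneg fun j _ => hnn j
  have hpow : (0 : ℝ) < 2 ^ n := by positivity
  refine hq ⟨max r₀ n, 2 ^ n + ∑ j ∈ Finset.range N, a j q ^ 2 / a j r₀, by linarith,
    fun j => ?_⟩
  have hpos : 0 ≤ a j (max r₀ n) := hA.1 _ _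
  rcases le_or_gt N j with hj | hj
  · calc a j q ^ 2 ≤ 2 ^ n * a j n := not_lt.1 (hN j hj)
      _ ≤ 2 ^ n * a j (max r₀ n) :=
        mul_le_mul_of_nonneg_left (hmono j (le_max_right _ _)) hpow.le
      _ ≤ _ := mul_le_mul_of_nonneg_right (by linarith) hpos
  · have h := Finset.single_le_sum (f := fun j => a j q ^ 2 / a j r₀)
      (fun j _ => hnn j) (Finset.mem_range.2 hj)
    calc a j q ^ 2 = a j q ^ 2 / a j r₀ * a j r₀ := (div_mul_cancel₀ _ (hr₀ j).ne').symm
      _ ≤ a j q ^ 2 / a j r₀ * a j (max r₀ n) :=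
        mul_le_mul_of_nonneg_left (hmono j (le_max_left _ _)) (hnn j)
      _ ≤ _ := mul_le_mul_of_nonneg_right (by linarith) hpos

/-- if `A` satisfies the nuclearity condition and `λ²(A)` is closed under
taking square roots, then `A² ≺ A`. -/
theorem statement4 (a : ℕ → ℕ → ℝ) (hA : KotheMatrix a)
    (h1 : NuclearityCond a)
    (hsqrt : ∀ ξ : ℕ → ℝ, (∀ j, 0 ≤ ξ j) → MemLam2 a (fun j => (ξ j : ℂ)) →
      MemLam2 a (fun j => (Real.sqrt (ξ j) : ℂ))) :
    KothePrec (kotheSq a) a := by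
  intro q
  by_contra hq
  have hmono : ∀ j, Monotone (a j) := fun j => monotone_nat_of_le_succ (hA.2.2 j)
  obtain ⟨r₀, hr₀, -⟩ := h1 0
  obtain ⟨φ, hφ, hlt⟩ := Filter.extraction_forall_of_frequently
    (frequently_lt_sq_of_not_exists_bound hA hr₀ hq)
  have hpos : ∀ n, 0 < a (φ n) q ^ 2 := fun n =>
    (mul_nonneg (by positivity) (hA.1 _ _)).trans_lt (hlt n)
  set ξ : ℕ → ℝ := Function.extend φ (fun n => (a (φ n) q ^ 2)⁻¹) 0 with hξ
  have hξφ : ∀ n, ξ (φ n) = (a (φ n) q ^ 2)⁻¹ := fun n => hφ.injective.extend_apply _ _ n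
  have hξ0 : ∀ j, j ∉ Set.range φ → ξ j = 0 := fun j hj =>
    Function.extend_apply' _ _ _ hj
  have hξnn : ∀ j, 0 ≤ ξ j := by
    intro j
    by_cases hj : j ∈ Set.range φ
    · obtain ⟨n, rfl⟩ := hj
      rw [hξφ]
      exact (inv_pos.2 (hpos n)).le
    · exact (hξ0 j hj).ge
  have hmem : MemLam2 a (fun j => (ξ j : ℂ)) := by
    intro p
    rw [← hφ.injective.summable_iff (fun j hj => by simp [hξ0 j hj])]
    have hgeom : Summable fun n : ℕ => ((1 / 4 : ℝ)) ^ n :=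
      summable_geometric_of_lt_one (by norm_num) (by norm_num)
    refine hgeom.of_norm_bounded_eventually_nat ?_
    filter_upwards [Filter.eventually_ge_atTop p] with n hn
    have hle : (a (φ n) q ^ 2)⁻¹ * a (φ n) p ≤ (1 / 2) ^ n := by
      rw [inv_mul_le_iff₀ (hpos n), one_div, inv_pow, ← div_eq_mul_inv,
        le_div_iff₀ (by positivity), mul_comm]
      exact (mul_le_mul_of_nonneg_left (hmono _ hn) (by positivity)).trans (hlt n).le
    have hnn : 0 ≤ (a (φ n) q ^ 2)⁻¹ * a (φ n) p :=
      mul_nonneg (inv_pos.2 (hpos n)).le (hA.1 _ _)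
    rw [Function.comp_apply, Complex.norm_real, Real.norm_of_nonneg (hξnn _), hξφ, ← mul_pow,
      Real.norm_of_nonneg (sq_nonneg _)]
    calc _ ≤ ((1 / 2 : ℝ) ^ n) ^ 2 := pow_le_pow_left₀ hnn hle 2
      _ = (1 / 4) ^ n := by rw [← pow_mul, mul_comm, pow_mul]; norm_num
  have hone := ((hsqrt ξ hξnn hmem q).comp_injective hφ.injective).tendsto_atTop_zero
  have heq : ((fun j => ‖(Real.sqrt (ξ j) : ℂ)‖ ^ 2 * a j q ^ 2) ∘ φ) = fun _ => (1 : ℝ) := by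
    funext n
    rw [Function.comp_apply, Complex.norm_real, Real.norm_of_nonneg (Real.sqrt_nonneg _),
      Real.sq_sqrt (hξnn _), hξφ, inv_mul_cancel₀ (hpos n).ne']
  rw [heq] at hone
  exact one_ne_zero (tendsto_nhds_unique tendsto_const_nhds hone)
end

section
/- Let F be a vector space with a norm ‖·‖, let E ⊆ F be a subspace, and let ‖·‖_E be a norm on E with ‖z‖_E ≤ ‖z‖ for all z ∈ E. Then for every x ∈ E one has ‖x‖_E ≤ √3 · inf_{z ∈ E} (‖z‖_E² + ‖x − z‖²)^{1/2}. -/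
/-- if `‖·‖` is a norm on `F`, `E ⊆ F` a subspace and `‖·‖_E` a norm on `E`
with `‖z‖_E ≤ ‖z‖` for `z ∈ E`, then for every `x ∈ E`,
`‖x‖_E ≤ √3 · inf_{z ∈ E} (‖z‖_E² + ‖x − z‖²)^{1/2}`. -/
theorem statement6 {F : Type*} [AddCommGroup F] [Module ℂ F]
    (N : F → ℝ)
    (hN_add : ∀ x y : F, N (x + y) ≤ N x + N y)
    (hN_smul : ∀ (c : ℂ) (x : F), N (c • x) = ‖c‖ * N x)
    (hN_norm : ∀ x : F, N x = 0 → x = 0)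
    (E : Submodule ℂ F)
    (NE : E → ℝ)
    (hNE_add : ∀ x y : E, NE (x + y) ≤ NE x + NE y)
    (hNE_smul : ∀ (c : ℂ) (x : E), NE (c • x) = ‖c‖ * NE x)
    (hNE_norm : ∀ x : E, NE x = 0 → x = 0)
    (hle : ∀ z : E, NE z ≤ N (z : F)) :
    ∀ x : E, NE x ≤ Real.sqrt 3 * ⨅ z : E, Real.sqrt (NE z ^ 2 + N ((x : F) - (z : F)) ^ 2) := by
  intro x
  rw [Real.mul_iInf_of_nonneg (Real.sqrt_nonneg 3)]
  refine le_ciInf fun z => ?_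
  have hdecomp : NE x ≤ NE z + N ((x : F) - (z : F)) :=
    calc NE x = NE (z + (x - z)) := by rw [add_sub_cancel]
      _ ≤ NE z + NE (x - z) := hNE_add _ _
      _ ≤ NE z + N ((x : F) - (z : F)) := by
        gcongr
        exact hle (x - z)
  rw [← Real.sqrt_mul (by norm_num)]
  refine hdecomp.trans (Real.le_sqrt_of_sq_le ?_)
  nlinarith [sq_nonneg (NE z - N ((x : F) - (z : F))), sq_nonneg (NE z),
    sq_nonneg (N ((x : F) - (z : F)))]
end

section
/- Let E be a closed subspace of s such that the quotient Fréchet space s/E admits a dominating norm. Then for every dominating Hilbert norm ‖·‖_E on E there exists a dominating Hilbert norm ‖·‖ on s whose restriction to E equals ‖·‖_E. -/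
/-- The `q`-th quotient seminorm of `s/E`: `x + E ↦ inf_{y ∈ E} |x − y|_q`. -/
noncomputable def quotSem (E : Set (ℕ → ℂ)) (q : ℕ) (x : ℕ → ℂ) : ℝ :=
  sInf {t : ℝ | ∃ y ∈ E, t = sNorm q (x - y)}

/-- Minkowski's inequality in the Euclidean plane. -/
lemma sqrt_sq_add_sq_le {a b c d e f : ℝ} (ha : 0 ≤ a) (hb : 0 ≤ b) (hac : a ≤ c + e)
    (hbd : b ≤ d + f) :
    √(a ^ 2 + b ^ 2) ≤ √(c ^ 2 + d ^ 2) + √(e ^ 2 + f ^ 2) := by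
  have h1 := Real.sq_sqrt (show 0 ≤ c ^ 2 + d ^ 2 by positivity)
  have h2 := Real.sq_sqrt (show 0 ≤ e ^ 2 + f ^ 2 by positivity)
  have h3 : c * e + d * f ≤ √(c ^ 2 + d ^ 2) * √(e ^ 2 + f ^ 2) := by
    refine le_of_abs_le (abs_le_of_sq_le_sq ?_ (by positivity))
    rw [mul_pow, h1, h2]
    nlinarith [sq_nonneg (c * f - d * e)]
  rw [Real.sqrt_le_left (by positivity)]
  nlinarith [mul_le_mul hac hac ha (ha.trans hac), mul_le_mul hbd hbd hb (hb.trans hbd)]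

/-- A Hilbert seminorm on a subspace, continuous for the pullback of a Hilbert space norm,
extends to a continuous Hilbert seminorm dominating the distance to the subspace. -/
theorem exists_hilbert_seminorm_extension {V H : Type*} [AddCommGroup V] [Module ℂ V]
    [NormedAddCommGroup H] [InnerProductSpace ℂ H] [CompleteSpace H]
    (J : V →ₗ[ℂ] H) (hJ : Function.Injective J) (E : Submodule ℂ V) (p : V → ℝ)
    (hp_add : ∀ x ∈ E, ∀ y ∈ E, p (x + y) ≤ p x + p y)
    (hp_smul : ∀ (c : ℂ), ∀ x ∈ E, p (c • x) = ‖c‖ * p x)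
    (hp_hilb : ∀ x ∈ E, ∀ y ∈ E, p (x + y) ^ 2 + p (x - y) ^ 2 = 2 * p x ^ 2 + 2 * p y ^ 2)
    (C : ℝ) (hC : 0 < C) (hp_cont : ∀ x ∈ E, p x ≤ C * ‖J x‖) :
    ∃ N : V → ℝ, (∀ x ∈ E, N x = p x) ∧ (∀ x y, N (x + y) ≤ N x + N y) ∧
      (∀ (c : ℂ) x, N (c • x) = ‖c‖ * N x) ∧
      (∀ x y, N (x + y) ^ 2 + N (x - y) ^ 2 = 2 * N x ^ 2 + 2 * N y ^ 2) ∧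
      (∀ x, N x ≤ (C + 2) * ‖J x‖) ∧
      (∀ (c : ℝ) x, (∀ y ∈ E, c ≤ ‖J (x - y)‖) → c ≤ N x) := by
  have hp_neg : ∀ x ∈ E, p (-x) = p x := fun x hx => by
    simpa using hp_smul (-1) x hx
  have hp_zero : p 0 = 0 := by simpa using hp_smul 0 0 E.zero_mem
  have hp_nonneg : ∀ x ∈ E, 0 ≤ p x := fun x hx => by
    have := hp_add x hx (-x) (E.neg_mem hx)
    rw [add_neg_cancel, hp_zero, hp_neg x hx] at this
    linarith
  have hp_sub : ∀ x ∈ E, ∀ y ∈ E, p x ≤ p y + C * ‖J x - J y‖ := fun x hx y hy => by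
    have h1 := hp_add y hy (x - y) (E.sub_mem hx hy)
    have h2 := hp_cont _ (E.sub_mem hx hy)
    rw [add_sub_cancel] at h1
    rw [map_sub] at h2
    linarith
  let F : Submodule ℂ H := E.map J
  have hlip : LipschitzOnWith (Real.toNNReal C) (fun h => p (Function.invFun J h)) (F : Set H) := by
    apply LipschitzOnWith.of_dist_le_mul
    rintro _ ⟨x, hx, rfl⟩ _ ⟨y, hy, rfl⟩
    simp only [Function.leftInverse_invFun hJ _]
    rw [Real.dist_eq, dist_eq_norm, Real.coe_toNNReal _ hC.le, abs_le]
    have h1 := hp_sub x hx y hy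
    have h2 := hp_sub y hy x hx
    rw [norm_sub_rev] at h2
    constructor <;> linarith
  obtain ⟨g, hg_lip, hg⟩ := hlip.extend_real
  have hgJ : ∀ x ∈ E, g (J x) = p x := fun x hx => by
    rw [← hg ⟨x, hx, rfl⟩]
    simp only [Function.leftInverse_invFun hJ _]
  have hgc : Continuous g := hg_lip.continuous
  let K : Submodule ℂ H := F.topologicalClosure
  have hKc : IsClosed (K : Set H) := F.isClosed_topologicalClosure
  have : CompleteSpace K := hKc.completeSpace_coe
  have ind : ∀ P : H → Prop, IsClosed {h | P h} → (∀ x ∈ E, P (J x)) → ∀ h ∈ K, P h := by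
    intro P hP h h' hh
    refine closure_minimal (s := (F : Set H)) ?_ hP hh
    rintro _ ⟨x, hx, rfl⟩
    exact h x hx
  have hg_nonneg : ∀ h ∈ K, 0 ≤ g h := ind _ (isClosed_le (by fun_prop) (by fun_prop))
    fun x hx => by rw [hgJ x hx]; exact hp_nonneg x hx
  have hg_le : ∀ h ∈ K, g h ≤ C * ‖h‖ := ind _ (isClosed_le (by fun_prop) (by fun_prop))
    fun x hx => by rw [hgJ x hx]; exact hp_cont x hx
  have hg_smul : ∀ c : ℂ, ∀ h ∈ K, g (c • h) = ‖c‖ * g h := fun c =>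
    ind _ (isClosed_eq (by fun_prop) (by fun_prop))
    fun x hx => by
      rw [hgJ x hx, ← map_smul, hgJ _ (E.smul_mem c hx)]
      exact hp_smul c x hx
  have hg_add : ∀ h ∈ K, ∀ h' ∈ K, g (h + h') ≤ g h + g h' := by
    intro h hh
    refine ind _ (isClosed_le (by fun_prop) (by fun_prop)) fun y hy => ?_
    revert h
    refine ind _ (isClosed_le (by fun_prop) (by fun_prop)) fun x hx => ?_
    rw [hgJ x hx, hgJ y hy, ← map_add, hgJ _ (E.add_mem hx hy)]
    exact hp_add x hx y hy
  have hg_hilb : ∀ h ∈ K, ∀ h' ∈ K,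
      g (h + h') ^ 2 + g (h - h') ^ 2 = 2 * g h ^ 2 + 2 * g h' ^ 2 := by
    intro h hh
    refine ind _ (isClosed_eq (by fun_prop) (by fun_prop)) fun y hy => ?_
    revert h
    refine ind _ (isClosed_eq (by fun_prop) (by fun_prop)) fun x hx => ?_
    rw [hgJ x hx, hgJ y hy, ← map_add, ← map_sub, hgJ _ (E.add_mem hx hy),
      hgJ _ (E.sub_mem hx hy)]
    exact hp_hilb x hx y hy
  let P : V →ₗ[ℂ] H := K.starProjection.toLinearMap ∘ₗ J
  have hPK : ∀ x, P x ∈ K := fun x => K.starProjection_apply_mem (J x)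
  have hPE : ∀ x ∈ E, P x = J x := fun x hx =>
    Submodule.starProjection_eq_self_iff.2 (F.le_topologicalClosure ⟨x, hx, rfl⟩)
  have hPle : ∀ x, ‖P x‖ ≤ ‖J x‖ := fun x => K.norm_starProjection_apply_le (J x)
  let R : V →ₗ[ℂ] H := J - P
  let N : V → ℝ := fun x => √(g (P x) ^ 2 + ‖R x‖ ^ 2)
  have hN_sq : ∀ x, N x ^ 2 = g (P x) ^ 2 + ‖R x‖ ^ 2 := fun x => Real.sq_sqrt (by positivity)
  refine ⟨N, fun x hx => ?_, fun x y => ?_, fun c x => ?_, fun x y => ?_, fun x => ?_,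
    fun c x h => ?_⟩
  · have : R x = 0 := by simp [R, hPE x hx]
    simp only [N]
    rw [this, hPE x hx, hgJ x hx]
    simp [Real.sqrt_sq (hp_nonneg x hx)]
  · refine sqrt_sq_add_sq_le (hg_nonneg _ (hPK _)) (norm_nonneg _) ?_ ?_
    · rw [map_add]
      exact hg_add _ (hPK x) _ (hPK y)
    · rw [map_add]
      exact norm_add_le _ _
  · simp only [N]
    rw [map_smul, map_smul, hg_smul c _ (hPK x), norm_smul, mul_pow, mul_pow, ← mul_add,
      Real.sqrt_mul (by positivity), Real.sqrt_sq (norm_nonneg c)]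
  · have h1 := hg_hilb _ (hPK x) _ (hPK y)
    have h2 := parallelogram_law_with_norm ℂ (R x) (R y)
    simp only [hN_sq, map_add, map_sub]
    linarith
  · have h1 := hg_le _ (hPK x)
    have h2 := hg_nonneg _ (hPK x)
    have h3 : ‖R x‖ ≤ ‖J x‖ + ‖P x‖ := norm_sub_le _ _
    have h4 := hPle x
    have h5 : g (P x) ≤ C * ‖J x‖ := h1.trans (by gcongr)
    have h6 : ‖R x‖ ≤ 2 * ‖J x‖ := by linarith
    rw [Real.sqrt_le_left (by positivity)]
    have h7 := norm_nonneg (R x)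
    nlinarith [mul_le_mul h5 h6 h7 (h2.trans h5), mul_nonneg h2 h7]
  · have h1 : ∀ z ∈ K, c ≤ ‖J x - z‖ := ind _ (isClosed_le (by fun_prop) (by fun_prop))
      fun y hy => by rw [← map_sub]; exact h y hy
    refine (h1 _ (hPK x)).trans (Real.le_sqrt_of_sq_le ?_)
    exact le_add_of_nonneg_left (sq_nonneg _)

/-- A weak interpolation inequality with exponents `1/4` and `3/4` improves to the
dominating norm inequality. -/
theorem sq_le_of_pow_four_le {V : Type*} (u : ℕ → V → ℝ) (hu : ∀ q x, 0 ≤ u q x)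
    (hmono : ∀ x, Monotone fun q => u q x) (N : V → ℝ) (hN : ∀ x, 0 ≤ N x)
    (hN_cont : ∃ k : ℕ, ∃ C : ℝ, 0 < C ∧ ∀ x, N x ≤ C * u k x)
    (h : ∀ q : ℕ, ∃ r : ℕ, ∃ C : ℝ, 0 < C ∧ ∀ x, u q x ^ 4 ≤ C * (N x * u r x ^ 3)) (q : ℕ) :
    ∃ r : ℕ, ∃ C : ℝ, 0 < C ∧ ∀ x, u q x ^ 2 ≤ C * N x * u r x := by
  obtain ⟨k, C, hC, hk⟩ := hN_cont
  obtain ⟨r₁, L₀, hL₀, h₀⟩ := h q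
  obtain ⟨r₂, L₁, hL₁, h₁⟩ := h r₁
  obtain ⟨r₃, L₂, hL₂, h₂⟩ := h r₂
  obtain ⟨c, hc⟩ : ∃ c, c = L₀ ^ 16 * L₁ ^ 12 * L₂ ^ 9 * C ^ 5 := ⟨_, rfl⟩
  refine ⟨max r₃ k, max 1 c, by positivity, fun x => ?_⟩
  have hw₁ : u r₃ x ≤ u (max r₃ k) x := hmono x (le_max_left _ _)
  have hw₂ : u k x ≤ u (max r₃ k) x := hmono x (le_max_right _ _)
  specialize h₀ x
  specialize h₁ x
  specialize h₂ x
  specialize hk x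
  have hn := hN x
  have ha := hu q x
  have hb := hu r₁ x
  have hd := hu r₂ x
  have he := hu r₃ x
  generalize u q x = a at *
  generalize u r₁ x = b at *
  generalize u r₂ x = d at *
  generalize u r₃ x = e at *
  generalize u (max r₃ k) x = w at *
  generalize N x = n at *
  have hw : 0 ≤ w := he.trans hw₁
  have hnw : n ≤ C * w := hk.trans (by gcongr)
  have h3 : d ^ 4 ≤ L₂ * (n * w ^ 3) := h₂.trans (by gcongr)
  have hM : c ≤ max 1 c ^ 32 :=
    (le_max_right 1 c).trans (le_self_pow₀ (le_max_left 1 c) (by norm_num))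
  refine (pow_le_pow_iff_left₀ (n := 32) (by positivity) (by positivity) (by norm_num)).1 ?_
  calc (a ^ 2) ^ 32 = (a ^ 4) ^ 16 := by ring
    _ ≤ (L₀ * (n * b ^ 3)) ^ 16 := by gcongr
    _ = L₀ ^ 16 * n ^ 16 * (b ^ 4) ^ 12 := by ring
    _ ≤ L₀ ^ 16 * n ^ 16 * (L₁ * (n * d ^ 3)) ^ 12 := by gcongr
    _ = L₀ ^ 16 * L₁ ^ 12 * n ^ 28 * (d ^ 4) ^ 9 := by ring
    _ ≤ L₀ ^ 16 * L₁ ^ 12 * n ^ 28 * (L₂ * (n * w ^ 3)) ^ 9 := by gcongr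
    _ = L₀ ^ 16 * L₁ ^ 12 * L₂ ^ 9 * n ^ 32 * w ^ 27 * n ^ 5 := by ring
    _ ≤ L₀ ^ 16 * L₁ ^ 12 * L₂ ^ 9 * n ^ 32 * w ^ 27 * (C * w) ^ 5 := by gcongr
    _ = c * (n ^ 32 * w ^ 32) := by rw [hc]; ring
    _ ≤ max 1 c ^ 32 * (n ^ 32 * w ^ 32) := by gcongr
    _ = (max 1 c * n * w) ^ 32 := by ring

/-- The elementary estimate combining the interpolation inequalities on a subspace and on
the quotient. -/
lemma pow_four_le_of_decomposition {A B C₁ C₃ z d v e w n : ℝ} (hA : 0 ≤ A) (hB : 0 ≤ B)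
    (hC₁ : 0 ≤ C₁) (hC₃ : 0 ≤ C₃) (hz : 0 ≤ z) (hd : 0 ≤ d)
    (hw : 0 ≤ w) (hn : 0 ≤ n) (hzdv : z ≤ d + v) (hdw : d ^ 2 ≤ A ^ 2 * (n * w))
    (hnw : n ≤ B ^ 2 * w) (hv : v ^ 2 ≤ C₁ * e * (w + d)) (hen : e ≤ n + C₃ * d) :
    z ^ 4 ≤ (2 * A ^ 2 * B + 2 * (C₁ * (B + C₃ * A) * (1 + A * B))) ^ 2 * (n * w ^ 3) := by
  obtain ⟨a, ha, rfl⟩ : ∃ a, 0 ≤ a ∧ n = a ^ 2 := ⟨√n, Real.sqrt_nonneg _, (Real.sq_sqrt hn).symm⟩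
  obtain ⟨b, hb, rfl⟩ : ∃ b, 0 ≤ b ∧ w = b ^ 2 := ⟨√w, Real.sqrt_nonneg _, (Real.sq_sqrt hw).symm⟩
  have hab : a ≤ B * b := by
    refine (pow_le_pow_iff_left₀ (n := 2) ha (by positivity) (by norm_num)).1 ?_
    linarith [mul_pow B b 2]
  have hdab : d ≤ A * (a * b) := by
    refine (pow_le_pow_iff_left₀ (n := 2) hd (by positivity) (by norm_num)).1 ?_
    linarith [mul_pow A (a * b) 2, mul_pow a b 2]
  have haa : a ^ 2 ≤ B * (a * b) := by nlinarith
  have habb : a * b ≤ B * b ^ 2 := by nlinarith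
  have he' : e ≤ (B + C₃ * A) * (a * b) := by
    nlinarith [mul_le_mul_of_nonneg_left hdab hC₃]
  have hwd : b ^ 2 + d ≤ (1 + A * B) * b ^ 2 := by
    nlinarith [mul_le_mul_of_nonneg_left habb hA]
  have hv' : v ^ 2 ≤ C₁ * ((B + C₃ * A) * (a * b)) * ((1 + A * B) * b ^ 2) :=
    hv.trans (by gcongr)
  have hd' : d ^ 2 ≤ A ^ 2 * B * (a * b ^ 3) := by
    refine hdw.trans ?_
    have : a ^ 2 * b ^ 2 ≤ B * (a * b) * b ^ 2 := by gcongr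
    nlinarith [mul_le_mul_of_nonneg_left this (sq_nonneg A)]
  have hz' : z ^ 2 ≤ (2 * A ^ 2 * B + 2 * (C₁ * (B + C₃ * A) * (1 + A * B))) * (a * b ^ 3) := by
    have : z ^ 2 ≤ (d + v) ^ 2 := by gcongr
    linarith [sq_nonneg (d - v)]
  calc z ^ 4 = (z ^ 2) ^ 2 := by ring
    _ ≤ ((2 * A ^ 2 * B + 2 * (C₁ * (B + C₃ * A) * (1 + A * B))) * (a * b ^ 3)) ^ 2 := by gcongr
    _ = _ := by ring

/-- If a subspace carries a dominating Hilbert norm and the quotient by it admits a dominating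
norm, then the Hilbert norm extends to a dominating Hilbert norm on the whole space. -/
theorem exists_dominating_hilbert_extension {V H : Type*} [AddCommGroup V] [Module ℂ V]
    [NormedAddCommGroup H] [InnerProductSpace ℂ H] [CompleteSpace H]
    (J : ℕ → V →ₗ[ℂ] H) (hJ : ∀ q, Function.Injective (J q))
    (hmono : ∀ x, Monotone fun q => ‖J q x‖) (E : Submodule ℂ V) (NQ : V → ℝ)
    (hNQ_cont : ∃ r : ℕ, ∃ C : ℝ, 0 < C ∧ ∀ x, ∀ y ∈ E, NQ x ≤ C * ‖J r (x - y)‖)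
    (hNQ_dom : ∀ q : ℕ, ∃ r : ℕ, ∃ C : ℝ, 0 < C ∧ ∀ x, ∃ y ∈ E,
      ‖J q (x - y)‖ ^ 2 ≤ C * NQ x * ‖J r x‖)
    (NE : V → ℝ)
    (hNE_add : ∀ x ∈ E, ∀ y ∈ E, NE (x + y) ≤ NE x + NE y)
    (hNE_smul : ∀ (c : ℂ), ∀ x ∈ E, NE (c • x) = ‖c‖ * NE x)
    (hNE_hilb : ∀ x ∈ E, ∀ y ∈ E,
      NE (x + y) ^ 2 + NE (x - y) ^ 2 = 2 * NE x ^ 2 + 2 * NE y ^ 2)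
    (hNE_cont : ∃ r : ℕ, ∃ C : ℝ, 0 < C ∧ ∀ x ∈ E, NE x ≤ C * ‖J r x‖)
    (hNE_dom : ∀ q : ℕ, ∃ r : ℕ, ∃ C : ℝ, 0 < C ∧ ∀ x ∈ E,
      ‖J q x‖ ^ 2 ≤ C * NE x * ‖J r x‖) :
    ∃ N : V → ℝ, (∀ x ∈ E, N x = NE x) ∧ (∀ x y, N (x + y) ≤ N x + N y) ∧
      (∀ (c : ℂ) x, N (c • x) = ‖c‖ * N x) ∧
      (∀ x y, N (x + y) ^ 2 + N (x - y) ^ 2 = 2 * N x ^ 2 + 2 * N y ^ 2) ∧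
      (∀ x, N x = 0 → x = 0) ∧
      (∃ r : ℕ, ∃ C : ℝ, 0 < C ∧ ∀ x, N x ≤ C * ‖J r x‖) ∧
      (∀ q : ℕ, ∃ r : ℕ, ∃ C : ℝ, 0 < C ∧ ∀ x, ‖J q x‖ ^ 2 ≤ C * N x * ‖J r x‖) := by
  obtain ⟨r₁, D₁, hD₁, hr₁⟩ := hNQ_cont
  obtain ⟨r₂, D₂, hD₂, hr₂⟩ := hNE_cont
  obtain ⟨k, hk⟩ : ∃ k, k = max r₁ r₂ := ⟨_, rfl⟩
  have hk₁ : r₁ ≤ k := by omega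
  have hk₂ : r₂ ≤ k := by omega
  obtain ⟨N, hN_eq, hN_add, hN_smul, hN_hilb, hN_cont, hN_dist⟩ :=
    exists_hilbert_seminorm_extension (J k) (hJ k) E NE hNE_add hNE_smul hNE_hilb D₂ hD₂
      fun x hx => (hr₂ x hx).trans (by gcongr; exact hmono x hk₂)
  have hN_nonneg : ∀ x, 0 ≤ N x := fun x => by
    have h1 := hN_add x (-x)
    have h2 := hN_smul (-1) x
    have h3 := hN_smul 0 0
    simp only [neg_smul, one_smul, norm_neg, norm_one, one_mul] at h2
    simp only [zero_smul, norm_zero, zero_mul] at h3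
    rw [add_neg_cancel, h3, h2] at h1
    linarith
  have hNQ_le : ∀ x, NQ x ≤ D₁ * N x := fun x => by
    rw [← div_le_iff₀' hD₁]
    refine hN_dist _ _ fun y hy => ?_
    rw [div_le_iff₀' hD₁]
    exact (hr₁ x y hy).trans (by gcongr; exact hmono _ hk₁)
  have hN_cont' : ∃ r : ℕ, ∃ C : ℝ, 0 < C ∧ ∀ x, N x ≤ C * ‖J r x‖ :=
    ⟨k, D₂ + 2, by positivity, hN_cont⟩
  have hN_dom : ∀ q : ℕ, ∃ r : ℕ, ∃ C : ℝ, 0 < C ∧ ∀ x, ‖J q x‖ ^ 2 ≤ C * N x * ‖J r x‖ := by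
    refine sq_le_of_pow_four_le (fun q x => ‖J q x‖) (fun _ _ => norm_nonneg _) hmono N
      hN_nonneg hN_cont' fun q => ?_
    obtain ⟨m, C₁, hC₁, hm⟩ := hNE_dom q
    obtain ⟨p, hp⟩ : ∃ p, p = max q (max m k) := ⟨_, rfl⟩
    obtain ⟨p', C₂, hC₂, hp'⟩ := hNQ_dom p
    obtain ⟨r, hr⟩ : ∃ r, r = max p p' := ⟨_, rfl⟩
    obtain ⟨A, hA0, hA⟩ : ∃ A, 0 < A ∧ A ^ 2 = C₂ * D₁ :=
      ⟨√(C₂ * D₁), by positivity, Real.sq_sqrt (by positivity)⟩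
    obtain ⟨B, hB0, hB⟩ : ∃ B, 0 < B ∧ B ^ 2 = D₂ + 2 :=
      ⟨√(D₂ + 2), by positivity, Real.sq_sqrt (by positivity)⟩
    refine ⟨r, (2 * A ^ 2 * B + 2 * (C₁ * (B + (D₂ + 2) * A) * (1 + A * B))) ^ 2, by positivity,
      fun x => ?_⟩
    obtain ⟨y, hy, hxy⟩ := hp' x
    refine pow_four_le_of_decomposition (d := ‖J p (x - y)‖) (v := ‖J q y‖) (e := NE y)
      (C₁ := C₁) (C₃ := D₂ + 2) (A := A) (B := B)
      hA0.le hB0.le hC₁.le (by positivity) (norm_nonneg _) (norm_nonneg _)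
      (norm_nonneg _) (hN_nonneg x) ?_ ?_ ?_ ?_ ?_
    · calc ‖J q x‖ = ‖J q (x - y) + J q y‖ := by rw [← map_add, sub_add_cancel]
        _ ≤ ‖J q (x - y)‖ + ‖J q y‖ := norm_add_le _ _
        _ ≤ _ := by gcongr; exact hmono _ (by omega)
    · rw [hA]
      calc ‖J p (x - y)‖ ^ 2 ≤ C₂ * NQ x * ‖J p' x‖ := hxy
        _ ≤ C₂ * (D₁ * N x) * ‖J r x‖ := by
          have := hN_nonneg x
          gcongr
          · exact hNQ_le x
          · exact hmono x (by omega)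
        _ = _ := by ring
    · rw [hB]
      exact (hN_cont x).trans (by gcongr; exact hmono x (by omega))
    · refine (hm y hy).trans ?_
      have : 0 ≤ NE y := hN_eq y hy ▸ hN_nonneg y
      gcongr
      calc ‖J m y‖ = ‖J m x - J m (x - y)‖ := by rw [← map_sub, sub_sub_cancel]
        _ ≤ ‖J m x‖ + ‖J m (x - y)‖ := norm_sub_le _ _
        _ ≤ _ := add_le_add (hmono _ (by omega)) (hmono _ (by omega))
    · have h1 := hN_add x (-(x - y))
      have h2 := hN_smul (-1) (x - y)
      simp only [neg_smul, one_smul, norm_neg, norm_one, one_mul] at h2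
      rw [h2, ← sub_eq_add_neg, sub_sub_cancel, hN_eq y hy] at h1
      refine h1.trans (by gcongr; exact (hN_cont _).trans (by gcongr; exact hmono _ (by omega)))
  refine ⟨N, hN_eq, hN_add, hN_smul, hN_hilb, fun x hx => ?_, hN_cont', hN_dom⟩
  obtain ⟨r, C, -, h⟩ := hN_dom 0
  have h0 := h x
  rw [hx, mul_zero, zero_mul] at h0
  refine hJ 0 ?_
  rw [map_zero, ← norm_eq_zero]
  exact pow_eq_zero_iff two_ne_zero |>.1 (le_antisymm h0 (sq_nonneg _))

/-- The `q`-th weighted sequence `j ↦ (j + 1) ^ q * ξ j`. -/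
noncomputable def sWeighted (q : ℕ) (ξ : ℕ → ℂ) : ℕ → ℂ := fun j => (sMatrix j q : ℂ) * ξ j

lemma sMatrix_pos (j q : ℕ) : 0 < sMatrix j q := by
  unfold sMatrix
  positivity

lemma norm_sWeighted_sq (q : ℕ) (ξ : ℕ → ℂ) (j : ℕ) :
    ‖sWeighted q ξ j‖ ^ 2 = ‖ξ j‖ ^ 2 * sMatrix j q ^ 2 := by
  rw [sWeighted, norm_mul, Complex.norm_real, Real.norm_of_nonneg (sMatrix_pos j q).le, mul_pow,
    mul_comm]

lemma memlp_sWeighted_iff (q : ℕ) (ξ : ℕ → ℂ) :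
    Memℓp (sWeighted q ξ) 2 ↔ Summable fun j => ‖ξ j‖ ^ 2 * sMatrix j q ^ 2 := by
  rw [memℓp_gen_iff (by norm_num)]
  simp [norm_sWeighted_sq]

lemma sWeighted_add (q : ℕ) (ξ η : ℕ → ℂ) :
    sWeighted q (ξ + η) = sWeighted q ξ + sWeighted q η := by
  ext j
  simp [sWeighted, mul_add]

lemma sWeighted_smul (q : ℕ) (c : ℂ) (ξ : ℕ → ℂ) :
    sWeighted q (c • ξ) = c • sWeighted q ξ := by
  ext j
  simp [sWeighted, mul_left_comm]

/-- The space `s` as a submodule of the space of all sequences. -/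
def sSubmodule : Submodule ℂ (ℕ → ℂ) where
  carrier := {ξ | MemS ξ}
  zero_mem' := fun q => by simp
  add_mem' := fun {ξ η} hξ hη q => by
    rw [← memlp_sWeighted_iff, sWeighted_add]
    exact ((memlp_sWeighted_iff q ξ).2 (hξ q)).add ((memlp_sWeighted_iff q η).2 (hη q))
  smul_mem' := fun c ξ hξ q => by
    rw [← memlp_sWeighted_iff, sWeighted_smul]
    exact ((memlp_sWeighted_iff q ξ).2 (hξ q)).const_smul c

/-- The weighting map from `s` to `ℓ²` inducing the `q`-th norm of `s`. -/
noncomputable def sToEll2 (q : ℕ) : sSubmodule →ₗ[ℂ] lp (fun _ : ℕ => ℂ) 2 where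
  toFun ξ := ⟨sWeighted q ξ, (memlp_sWeighted_iff q ξ).2 (ξ.2 q)⟩
  map_add' ξ η := Subtype.ext (sWeighted_add q ξ η)
  map_smul' c ξ := Subtype.ext (sWeighted_smul q c ξ)

lemma sToEll2_injective (q : ℕ) : Function.Injective (sToEll2 q) := by
  intro ξ η h
  ext j
  have : sWeighted q ξ j = sWeighted q η j := congrFun (congrArg Subtype.val h) j
  exact mul_left_cancel₀ (Complex.ofReal_ne_zero.2 (sMatrix_pos j q).ne') this

lemma norm_sToEll2 (q : ℕ) (ξ : sSubmodule) : ‖sToEll2 q ξ‖ = sNorm q ξ := by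
  have h : ‖sToEll2 q ξ‖ ^ 2 = ∑' j, ‖(ξ : ℕ → ℂ) j‖ ^ 2 * sMatrix j q ^ 2 := by
    have := lp.norm_rpow_eq_tsum (p := 2) (by norm_num) (sToEll2 q ξ)
    simp only [ENNReal.toReal_ofNat, Real.rpow_ofNat] at this
    rw [this]
    exact tsum_congr (norm_sWeighted_sq q ξ)
  rw [sNorm, lam2Norm, ← h, Real.sqrt_sq (norm_nonneg _)]

lemma sNorm_mono (ξ : sSubmodule) : Monotone fun q => sNorm q ξ := by
  refine monotone_nat_of_le_succ fun q => Real.sqrt_le_sqrt ?_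
  refine (ξ.2 q).tsum_le_tsum (fun j => ?_) (ξ.2 (q + 1))
  have h : sMatrix j q ≤ sMatrix j (q + 1) :=
    pow_le_pow_right₀ (by linarith [j.cast_nonneg (α := ℝ)]) q.le_succ
  have := sMatrix_pos j q
  gcongr

lemma sNorm_nonneg (q : ℕ) (ξ : ℕ → ℂ) : 0 ≤ sNorm q ξ := Real.sqrt_nonneg _

lemma quotSem_le {E : Set (ℕ → ℂ)} {y : ℕ → ℂ} (hy : y ∈ E) (q : ℕ) (x : ℕ → ℂ) :
    quotSem E q x ≤ sNorm q (x - y) := by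
  refine csInf_le ⟨0, ?_⟩ ⟨y, hy, rfl⟩
  rintro _ ⟨z, -, rfl⟩
  exact sNorm_nonneg _ _

/-- Corollary 3.10: let `E` be a closed subspace of `s` such that the
quotient `s/E` admits a dominating norm. Then every dominating Hilbert norm `‖·‖_E` on `E`
extends to a dominating Hilbert norm on `s`. All norms are encoded as real-valued
functions; continuity and the dominating property are expressed through the fundamental
system of norms `(sNorm q)` of `s` (and the quotient seminorms `quotSem E q` on `s/E`). -/
theorem statement10 (E : Set (ℕ → ℂ))
    -- `E` is a subspace of `s`
    (hEs : ∀ ξ ∈ E, MemS ξ)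
    (hE0 : (0 : ℕ → ℂ) ∈ E)
    (hEadd : ∀ ξ ∈ E, ∀ η ∈ E, ξ + η ∈ E)
    (hEsmul : ∀ (c : ℂ), ∀ ξ ∈ E, c • ξ ∈ E)
    -- `E` is closed in `s`
    (hEclosed : ∀ ξ : ℕ → ℂ, MemS ξ →
      (∀ q : ℕ, ∀ ε : ℝ, 0 < ε → ∃ η ∈ E, sNorm q (ξ - η) < ε) → ξ ∈ E)
    -- the quotient `s/E` admits a dominating norm `NQ` (a function on `s` constant on
    -- `E`-cosets, i.e. a seminorm on `s/E`, which is a norm on `s/E`, continuous and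
    -- dominating with respect to the quotient seminorms)
    (hquot : ∃ NQ : (ℕ → ℂ) → ℝ,
      (∀ x : ℕ → ℂ, MemS x → ∀ y ∈ E, NQ (x + y) = NQ x) ∧
      (∀ x y : ℕ → ℂ, MemS x → MemS y → NQ (x + y) ≤ NQ x + NQ y) ∧
      (∀ (c : ℂ) (x : ℕ → ℂ), MemS x → NQ (c • x) = ‖c‖ * NQ x) ∧
      (∀ x : ℕ → ℂ, MemS x → NQ x = 0 → x ∈ E) ∧
      (∃ r : ℕ, ∃ C : ℝ, 0 < C ∧ ∀ x : ℕ → ℂ, MemS x → NQ x ≤ C * sNorm r x) ∧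
      (∀ q : ℕ, ∃ r : ℕ, ∃ C : ℝ, 0 < C ∧ ∀ x : ℕ → ℂ, MemS x →
        quotSem E q x ^ 2 ≤ C * NQ x * quotSem E r x))
    -- a dominating Hilbert norm on `E`
    (NE : (ℕ → ℂ) → ℝ)
    (hNE_add : ∀ x ∈ E, ∀ y ∈ E, NE (x + y) ≤ NE x + NE y)
    (hNE_smul : ∀ (c : ℂ), ∀ x ∈ E, NE (c • x) = ‖c‖ * NE x)
    (hNE_hilb : ∀ x ∈ E, ∀ y ∈ E,
      NE (x + y) ^ 2 + NE (x - y) ^ 2 = 2 * NE x ^ 2 + 2 * NE y ^ 2)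
    (hNE_norm : ∀ x ∈ E, NE x = 0 → x = 0)
    (hNE_cont : ∃ r : ℕ, ∃ C : ℝ, 0 < C ∧ ∀ x ∈ E, NE x ≤ C * sNorm r x)
    (hNE_dom : ∀ q : ℕ, ∃ r : ℕ, ∃ C : ℝ, 0 < C ∧ ∀ x ∈ E,
      sNorm q x ^ 2 ≤ C * NE x * sNorm r x) :
    -- there is a dominating Hilbert norm on `s` restricting to `‖·‖_E` on `E`
    ∃ N : (ℕ → ℂ) → ℝ,
      (∀ x ∈ E, N x = NE x) ∧
      (∀ x y : ℕ → ℂ, MemS x → MemS y → N (x + y) ≤ N x + N y) ∧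
      (∀ (c : ℂ) (x : ℕ → ℂ), MemS x → N (c • x) = ‖c‖ * N x) ∧
      (∀ x y : ℕ → ℂ, MemS x → MemS y →
        N (x + y) ^ 2 + N (x - y) ^ 2 = 2 * N x ^ 2 + 2 * N y ^ 2) ∧
      (∀ x : ℕ → ℂ, MemS x → N x = 0 → x = 0) ∧
      (∃ r : ℕ, ∃ C : ℝ, 0 < C ∧ ∀ x : ℕ → ℂ, MemS x → N x ≤ C * sNorm r x) ∧
      (∀ q : ℕ, ∃ r : ℕ, ∃ C : ℝ, 0 < C ∧ ∀ x : ℕ → ℂ, MemS x →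
        sNorm q x ^ 2 ≤ C * N x * sNorm r x) := by
  classical
  obtain ⟨NQ, hNQ_coset, hNQ_add, hNQ_smul, hNQ_norm, ⟨r₀, C₀, hC₀, hNQ_cont⟩, hNQ_dom⟩ := hquot
  let E' : Submodule ℂ sSubmodule :=
    { carrier := {x | (x : ℕ → ℂ) ∈ E}
      zero_mem' := hE0
      add_mem' := fun {x y} hx hy => hEadd x hx y hy
      smul_mem' := fun c x hx => hEsmul c x hx }
  have hNQ_nonneg : ∀ x : sSubmodule, 0 ≤ NQ x := fun x => by
    have h1 := hNQ_add x (-x) x.2 (-x).2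
    have h2 := hNQ_smul (-1) x x.2
    have h3 := hNQ_smul 0 x x.2
    simp only [neg_smul, one_smul, norm_neg, norm_one, one_mul] at h2
    simp only [zero_smul, norm_zero, zero_mul] at h3
    rw [add_neg_cancel, h3, h2] at h1
    linarith
  obtain ⟨N, hN_eq, hN_add, hN_smul, hN_hilb, hN_norm, ⟨r, C, hC, hN_cont⟩, hN_dom⟩ :=
    exists_dominating_hilbert_extension sToEll2 sToEll2_injective
      (by simpa only [norm_sToEll2] using sNorm_mono) E' (fun x => NQ x)
      ⟨r₀, C₀, hC₀, fun x y hy => by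
        have h := hNQ_coset (x - y : sSubmodule) (x - y).2 y hy
        rw [Submodule.coe_sub, sub_add_cancel] at h
        rw [norm_sToEll2, h]
        exact hNQ_cont _ (x - y).2⟩
      (fun q => by
        obtain ⟨r, C, hC, h⟩ := hNQ_dom q
        refine ⟨r, 2 * C, by positivity, fun x => ?_⟩
        by_cases hx : (x : ℕ → ℂ) ∈ E
        · refine ⟨x, hx, ?_⟩
          have := hNQ_nonneg x
          rw [sub_self, map_zero, norm_zero, zero_pow two_ne_zero]
          positivity
        · have hNx : 0 < NQ x := (hNQ_nonneg x).lt_of_ne' fun h0 => hx (hNQ_norm x x.2 h0)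
          have hJx : 0 < ‖sToEll2 r x‖ := by
            rw [norm_pos_iff, Ne, map_eq_zero_iff _ (sToEll2_injective r)]
            rintro rfl
            exact hx hE0
          have hle : quotSem E r x ≤ ‖sToEll2 r x‖ := by
            simpa [norm_sToEll2] using quotSem_le hE0 r x
          have hpos : 0 < C * NQ x * ‖sToEll2 r x‖ := by positivity
          have hlt : quotSem E q x < √(2 * C * NQ x * ‖sToEll2 r x‖) := by
            refine Real.lt_sqrt_of_sq_lt ?_
            calc quotSem E q x ^ 2 ≤ C * NQ x * quotSem E r x := h x x.2
              _ ≤ C * NQ x * ‖sToEll2 r x‖ := by gcongr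
              _ < 2 * C * NQ x * ‖sToEll2 r x‖ := by linarith
          have hne : {t : ℝ | ∃ y ∈ E, t = sNorm q (x - y)}.Nonempty := ⟨_, 0, hE0, rfl⟩
          obtain ⟨_, ⟨y, hy, rfl⟩, hlt'⟩ := exists_lt_of_csInf_lt hne hlt
          refine ⟨⟨y, hEs y hy⟩, hy, ?_⟩
          rw [norm_sToEll2]
          exact ((Real.lt_sqrt (sNorm_nonneg _ _)).1 hlt').le)
      (fun x => NE x) (fun x hx y hy => hNE_add x hx y hy) (fun c x hx => hNE_smul c x hx)
      (fun x hx y hy => hNE_hilb x hx y hy)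
      (by
        obtain ⟨r, C, hC, h⟩ := hNE_cont
        exact ⟨r, C, hC, fun x hx => by rw [norm_sToEll2]; exact h x hx⟩)
      (fun q => by
        obtain ⟨r, C, hC, h⟩ := hNE_dom q
        exact ⟨r, C, hC, fun x hx => by rw [norm_sToEll2, norm_sToEll2]; exact h x hx⟩)
  simp only [norm_sToEll2] at hN_cont hN_dom
  let N' : (ℕ → ℂ) → ℝ := fun x => if h : MemS x then N ⟨x, h⟩ else 0
  have hN' : ∀ x : sSubmodule, N' x = N x := fun x => dif_pos x.2
  refine ⟨N', fun x hx => ?_, fun x y hx hy => ?_, fun c x hx => ?_, fun x y hx hy => ?_,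
    fun x hx h => ?_, ⟨r, C, hC, fun x hx => ?_⟩, fun q => ?_⟩
  · exact (hN' ⟨x, hEs x hx⟩).trans (hN_eq ⟨x, hEs x hx⟩ hx)
  · lift x to sSubmodule using hx
    lift y to sSubmodule using hy
    rw [← Submodule.coe_add, hN', hN', hN']
    exact hN_add x y
  · lift x to sSubmodule using hx
    rw [← Submodule.coe_smul, hN', hN']
    exact hN_smul c x
  · lift x to sSubmodule using hx
    lift y to sSubmodule using hy
    rw [← Submodule.coe_add, ← Submodule.coe_sub, hN', hN', hN', hN']
    exact hN_hilb x y
  · lift x to sSubmodule using hx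
    rw [hN'] at h
    rw [hN_norm x h, Submodule.coe_zero]
  · lift x to sSubmodule using hx
    rw [hN']
    exact hN_cont x
  · obtain ⟨r, C, hC, h⟩ := hN_dom q
    refine ⟨r, C, hC, fun x hx => ?_⟩
    lift x to sSubmodule using hx
    rw [hN']
    exact h x
end
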